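/- arXiv:2511.17002 — 3 statements merged into one kernel-verified Lean document; each statement's English description precedes it below -/
import Mathlib

section
/- Let Ω ⊆ ℝ^N be a bounded domain with 0 ∈ Ω and assume θ ≤ −2. Then there is no positive function u of class C² on Ω∖{0} and continuous on (closure of Ω)∖{0} that satisfies the equation Δu − (N−2+2ρ)(x·∇u)/|x|² + λ u^τ|∇u|^{1−τ}/|x|^{1+τ} = |x|^θ u^q pointwise in Ω∖{0} and vanishes on the boundary ∂Ω. -/
open MeasureTheory Filter Topology Real RealInnerProductSpace

noncomputable section

/-- The gradient factor `G_τ(x,z,ξ) = z^τ ‖ξ‖^(1-τ) / ‖x‖^(τ+1)`.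
For `τ = 0` this equals `‖ξ‖ / ‖x‖`, since `z ^ (0:ℝ) = 1` for real powers. -/
def Gt {N : ℕ} (τ : ℝ) (x : EuclideanSpace ℝ (Fin N)) (z : ℝ)
    (ξ : EuclideanSpace ℝ (Fin N)) : ℝ :=
  z ^ τ * ‖ξ‖ ^ (1 - τ) / ‖x‖ ^ (τ + 1)

/-- Test functions: `C¹` functions with compact support contained in `Ω \ {0}`. -/
def IsTestFun {N : ℕ} (Ω : Set (EuclideanSpace ℝ (Fin N)))
    (φ : EuclideanSpace ℝ (Fin N) → ℝ) : Prop :=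
  ContDiff ℝ 1 φ ∧ HasCompactSupport φ ∧ tsupport φ ⊆ Ω \ {0}

/-- The distributional pairing of equation (E) with a test function `φ`:
`∫ ∇u·∇φ + (N-2+2ρ) ∫ ((x·∇u)/|x|²) φ - λ ∫ G_τ(x,u,∇u) φ + ∫ |x|^θ u^q φ`. -/
def weakE (N : ℕ) (ρ lam τ θ q : ℝ) (Ω : Set (EuclideanSpace ℝ (Fin N)))
    (u φ : EuclideanSpace ℝ (Fin N) → ℝ) : ℝ :=
  (∫ x in Ω \ {0}, ⟪gradient u x, gradient φ x⟫)
    + ((N : ℝ) - 2 + 2 * ρ) * (∫ x in Ω \ {0}, ⟪x, gradient u x⟫ / ‖x‖ ^ 2 * φ x)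
    - lam * (∫ x in Ω \ {0}, Gt τ x (u x) (gradient u x) * φ x)
    + ∫ x in Ω \ {0}, ‖x‖ ^ θ * u x ^ q * φ x

/-- A positive `C¹` function on `Ω \ {0}`. -/
def PosC1 {N : ℕ} (Ω : Set (EuclideanSpace ℝ (Fin N)))
    (u : EuclideanSpace ℝ (Fin N) → ℝ) : Prop :=
  ContDiffOn ℝ 1 u (Ω \ {0}) ∧ ∀ x ∈ Ω \ {0}, 0 < u x

/-- Positive distributional solution of equation (E) in `Ω \ {0}`. -/
def IsSolutionE (N : ℕ) (ρ lam τ θ q : ℝ) (Ω : Set (EuclideanSpace ℝ (Fin N)))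
    (u : EuclideanSpace ℝ (Fin N) → ℝ) : Prop :=
  PosC1 Ω u ∧ ∀ φ, IsTestFun Ω φ → weakE N ρ lam τ θ q Ω u φ = 0

/-- Positive sub-solution of equation (E) in `Ω \ {0}`. -/
def IsSubSolutionE (N : ℕ) (ρ lam τ θ q : ℝ) (Ω : Set (EuclideanSpace ℝ (Fin N)))
    (u : EuclideanSpace ℝ (Fin N) → ℝ) : Prop :=
  PosC1 Ω u ∧ ∀ φ, IsTestFun Ω φ → (∀ x, 0 ≤ φ x) → weakE N ρ lam τ θ q Ω u φ ≤ 0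

/-- Positive super-solution of equation (E) in `Ω \ {0}`. -/
def IsSuperSolutionE (N : ℕ) (ρ lam τ θ q : ℝ) (Ω : Set (EuclideanSpace ℝ (Fin N)))
    (u : EuclideanSpace ℝ (Fin N) → ℝ) : Prop :=
  PosC1 Ω u ∧ ∀ φ, IsTestFun Ω φ → (∀ x, 0 ≤ φ x) → 0 ≤ weakE N ρ lam τ θ q Ω u φ

/-- `f_ρ(t) = t (t + 2ρ) + λ |t|^(1-τ)`. -/
def fRho (ρ lam τ t : ℝ) : ℝ := t * (t + 2 * ρ) + lam * |t| ^ (1 - τ)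

/-- `Υ = ((τ+1)/(2τ)) (λτ)^(1/(τ+1))`. -/
def Upsilon (lam τ : ℝ) : ℝ := ((τ + 1) / (2 * τ)) * (lam * τ) ^ (1 / (τ + 1))

/-- Case [N₀]: (a) `τ = 0` and `λ ≥ 2ρ`, or (b) `λ > 0`, `τ ∈ (0,1)` and `ρ < Υ`. -/
def CaseN0 (ρ lam τ : ℝ) : Prop :=
  (τ = 0 ∧ 2 * ρ ≤ lam) ∨ (0 < lam ∧ 0 < τ ∧ τ < 1 ∧ ρ < Upsilon lam τ)

/-- Case [N₁]: (a) `τ = 0` and `λ < 2ρ`, or (b) `λ < 0` and `τ ∈ (0,1)`. -/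
def CaseN1 (ρ lam τ : ℝ) : Prop :=
  (τ = 0 ∧ lam < 2 * ρ) ∨ (lam < 0 ∧ 0 < τ ∧ τ < 1)

/-- Case [N₂]: `λ > 0`, `τ ∈ (0,1)` and `ρ ≥ Υ`. -/
def CaseN2 (ρ lam τ : ℝ) : Prop :=
  0 < lam ∧ 0 < τ ∧ τ < 1 ∧ Upsilon lam τ ≤ ρ

/-- `w` is the smallest negative root of `f_ρ` (i.e. `w = ϖ₁`). -/
def IsMinNegRoot (ρ lam τ w : ℝ) : Prop :=
  w < 0 ∧ fRho ρ lam τ w = 0 ∧ ∀ t, t < 0 → fRho ρ lam τ t = 0 → w ≤ t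

/-- `w` is the largest negative root of `f_ρ` (i.e. `w = ϖ₂`). -/
def IsMaxNegRoot (ρ lam τ w : ℝ) : Prop :=
  w < 0 ∧ fRho ρ lam τ w = 0 ∧ ∀ t, t < 0 → fRho ρ lam τ t = 0 → t ≤ w

/-- `Φ_{ϖ₂}(r)`: equal to `r^(-ϖ₂)` if `ρ > Υ` and to `r^(-ϖ₂) |log r|^(2/(1+τ))` if `ρ = Υ`. -/
def Phi2 (ρ lam τ w2 r : ℝ) : ℝ :=
  if ρ = Upsilon lam τ then r ^ (-w2) * |Real.log r| ^ (2 / (1 + τ)) else r ^ (-w2)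

/-- `Ψ_{ϖ₁}(t)`: equal to `t^(-ϖ₁)` if `ρ > Υ` and to `t^(-ϖ₁) (log t)^(2/(1+τ))` if `ρ = Υ`. -/
def Psi1 (ρ lam τ w1 t : ℝ) : ℝ :=
  if ρ = Upsilon lam τ then t ^ (-w1) * (Real.log t) ^ (2 / (1 + τ)) else t ^ (-w1)

/-- The radial operator `L_{ρ,λ,τ}[P](r) = P'' + (1-2ρ) P'/r + λ P^τ |P'|^(1-τ)/r^(1+τ)`. -/
def Lrad (ρ lam τ : ℝ) (P : ℝ → ℝ) (r : ℝ) : ℝ :=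
  deriv (deriv P) r + (1 - 2 * ρ) * deriv P r / r
    + lam * P r ^ τ * |deriv P r| ^ (1 - τ) / r ^ (1 + τ)

/-- The Laplacian of `u` at `x`, as the trace of the second derivative. -/
def lapl {N : ℕ} (u : EuclideanSpace ℝ (Fin N) → ℝ) (x : EuclideanSpace ℝ (Fin N)) : ℝ :=
  ∑ i : Fin N, iteratedFDeriv ℝ 2 u x ![EuclideanSpace.single i 1, EuclideanSpace.single i 1]

/-- First and second order necessary conditions at a local minimum of a real function. -/
lemma deriv_eq_zero_and_second_deriv_nonneg {g g₁ : ℝ → ℝ} {a b : ℝ}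
    (hg : ∀ᶠ t in 𝓝 a, HasDerivAt g (g₁ t) t) (hg₁ : HasDerivAt g₁ b a)
    (hmin : IsLocalMin g a) : g₁ a = 0 ∧ 0 ≤ b := by
  have h0 : g₁ a = 0 := hmin.hasDerivAt_eq_zero hg.self_of_nhds
  refine ⟨h0, ?_⟩
  by_contra! hb
  have hd : deriv g =ᶠ[𝓝 a] g₁ := hg.mono fun t ht => ht.deriv
  have hdd : deriv (deriv g) a = b := hd.deriv_eq.trans hg₁.deriv
  have hmax : IsLocalMax g a :=
    isLocalMax_of_deriv_deriv_neg (hdd ▸ hb) (hd.self_of_nhds.trans h0)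
      hg.self_of_nhds.continuousAt
  have hconst : g =ᶠ[𝓝 a] fun _ => g a := by
    filter_upwards [hmin, hmax] with t h₁ h₂ using le_antisymm h₂ h₁
  have hzero : deriv (deriv g) a = 0 := by
    rw [hconst.deriv.deriv_eq]
    simp
  linarith

/-- A `C²` function has the expected second derivative along a line. -/
lemma hasDerivAt_line {E : Type*} [NormedAddCommGroup E] [NormedSpace ℝ E] {u : E → ℝ} {p : E}
    (hu : ContDiffAt ℝ 2 u p) (v : E) :
    (∀ᶠ t in 𝓝 (0 : ℝ),
      HasDerivAt (fun t : ℝ => u (p + t • v)) (fderiv ℝ u (p + t • v) v) t) ∧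
    HasDerivAt (fun t : ℝ => fderiv ℝ u (p + t • v) v) (iteratedFDeriv ℝ 2 u p ![v, v]) 0 := by
  have hline : ∀ t : ℝ, HasDerivAt (fun t : ℝ => p + t • v) v t := fun t => by
    simpa using ((hasDerivAt_id t).smul_const v).const_add p
  have hcont : Tendsto (fun t : ℝ => p + t • v) (𝓝 0) (𝓝 p) := by
    simpa using (hline 0).continuousAt.tendsto
  constructor
  · have hdiff : ∀ᶠ x in 𝓝 p, DifferentiableAt ℝ u x :=
      (hu.eventually (by simp)).mono fun x hx => hx.differentiableAt (by norm_num)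
    filter_upwards [hcont.eventually hdiff] with t ht
    exact ht.hasFDerivAt.comp_hasDerivAt t (hline t)
  · have h1 : DifferentiableAt ℝ (fderiv ℝ u) (p + (0 : ℝ) • v) := by
      simpa using (hu.fderiv_right (m := 1) (by norm_num)).differentiableAt (by norm_num)
    have h2 : HasDerivAt (fun t : ℝ => fderiv ℝ u (p + t • v))
        (fderiv ℝ (fderiv ℝ u) (p + (0 : ℝ) • v) v) 0 :=
      h1.hasFDerivAt.comp_hasDerivAt (0 : ℝ) (hline 0)
    have h3 := h2.clm_apply (hasDerivAt_const (0 : ℝ) v)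
    simpa [iteratedFDeriv_two_apply] using h3

/-- If the radial function `x ↦ H (‖x‖ ^ 2)` touches `u` from above at `p`, then the gradients
agree at `p` and the Laplacian of `u` is at most that of the radial function. -/
lemma gradient_eq_and_lapl_le_of_radial_touching {N : ℕ} {u : EuclideanSpace ℝ (Fin N) → ℝ}
    {p : EuclideanSpace ℝ (Fin N)} (hu : ContDiffAt ℝ 2 u p) {H H₁ : ℝ → ℝ} {b : ℝ}
    (hH : ∀ᶠ s in 𝓝 (‖p‖ ^ 2), HasDerivAt H (H₁ s) s) (hH₁ : HasDerivAt H₁ b (‖p‖ ^ 2))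
    (heq : u p = H (‖p‖ ^ 2)) (hle : ∀ᶠ x in 𝓝 p, u x ≤ H (‖x‖ ^ 2)) :
    gradient u p = (2 * H₁ (‖p‖ ^ 2)) • p ∧
      lapl u p ≤ 4 * ‖p‖ ^ 2 * b + 2 * N * H₁ (‖p‖ ^ 2) := by
  have key : ∀ v : EuclideanSpace ℝ (Fin N),
      fderiv ℝ u p v = 2 * H₁ (‖p‖ ^ 2) * ⟪p, v⟫ ∧
      iteratedFDeriv ℝ 2 u p ![v, v] ≤
        4 * ⟪p, v⟫ ^ 2 * b + 2 * ‖v‖ ^ 2 * H₁ (‖p‖ ^ 2) := by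
    intro v
    obtain ⟨hu1, hu2⟩ := hasDerivAt_line hu v
    set S : ℝ → ℝ := fun t => ‖p + t • v‖ ^ 2 with hS
    have hSeq : ∀ t, S t = ‖p‖ ^ 2 + 2 * t * ⟪p, v⟫ + t ^ 2 * ‖v‖ ^ 2 := fun t => by
      change ‖p + t • v‖ ^ 2 = _
      rw [norm_add_sq_real, inner_smul_right, norm_smul, mul_pow, Real.norm_eq_abs, sq_abs]
      ring
    have hSd : ∀ t, HasDerivAt S (2 * ⟪p, v⟫ + 2 * t * ‖v‖ ^ 2) t := fun t => by
      rw [funext hSeq]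
      have := ((((hasDerivAt_id t).const_mul 2).mul_const ⟪p, v⟫).const_add (‖p‖ ^ 2)).add
        (((hasDerivAt_id t).pow 2).mul_const (‖v‖ ^ 2))
      exact this.congr_deriv (by simp)
    have hSd2 : HasDerivAt (fun t : ℝ => 2 * ⟪p, v⟫ + 2 * t * ‖v‖ ^ 2) (2 * ‖v‖ ^ 2) 0 := by
      simpa using (((hasDerivAt_id (0 : ℝ)).const_mul 2).mul_const (‖v‖ ^ 2)).const_add
        (2 * ⟪p, v⟫)
    have hS0 : S 0 = ‖p‖ ^ 2 := by simp [hS]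
    have hScont : Tendsto S (𝓝 0) (𝓝 (‖p‖ ^ 2)) := hS0 ▸ (hSd 0).continuousAt.tendsto
    have hline : Tendsto (fun t : ℝ => p + t • v) (𝓝 0) (𝓝 p) := by
      have : Continuous fun t : ℝ => p + t • v := by fun_prop
      simpa using this.tendsto 0
    have hmin : IsLocalMin (fun t : ℝ => H (S t) - u (p + t • v)) 0 := by
      filter_upwards [hline.eventually hle] with t ht
      simp only [hS0, zero_smul, add_zero, ← heq, sub_self]
      exact sub_nonneg.2 ht
    have hd1 : ∀ᶠ t in 𝓝 (0 : ℝ), HasDerivAt (fun t : ℝ => H (S t) - u (p + t • v))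
        (H₁ (S t) * (2 * ⟪p, v⟫ + 2 * t * ‖v‖ ^ 2) - fderiv ℝ u (p + t • v) v) t := by
      filter_upwards [hu1, hScont.eventually hH] with t h₁ h₂
      exact (h₂.comp t (hSd t)).sub h₁
    have hd2 := (((hS0 ▸ hH₁ : HasDerivAt H₁ b (S 0)).comp (0 : ℝ) (hSd 0)).mul hSd2).sub hu2
    obtain ⟨h₁, h₂⟩ := deriv_eq_zero_and_second_deriv_nonneg hd1 hd2 hmin
    simp only [hS0, Function.comp, mul_zero, zero_mul, add_zero, zero_smul] at h₁ h₂
    constructor <;> linarith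
  constructor
  · refine ext_inner_right ℝ fun v => ?_
    rw [inner_smul_left, gradient, InnerProductSpace.toDual_symm_apply, (key v).1]
    simp
  · have hnorm : ‖p‖ ^ 2 = ∑ i, p i ^ 2 := by
      simp [EuclideanSpace.norm_sq_eq]
    calc lapl u p ≤ ∑ i : Fin N, (4 * p i ^ 2 * b + 2 * H₁ (‖p‖ ^ 2)) := by
          refine Finset.sum_le_sum fun i _ => ?_
          simpa [EuclideanSpace.inner_single_right] using (key (EuclideanSpace.single i 1)).2
      _ = 4 * ‖p‖ ^ 2 * b + 2 * N * H₁ (‖p‖ ^ 2) := by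
          rw [Finset.sum_add_distrib, ← Finset.sum_mul, ← Finset.mul_sum, ← hnorm]
          simp
          ring

/-- Derivative of the base `s ↦ 1 - c s ^ (-δ)` of the barrier. -/
lemma hasDerivAt_barrierBase (c δ : ℝ) {s : ℝ} (hs : 0 < s) :
    HasDerivAt (fun s : ℝ => 1 - c * s ^ (-δ)) (δ * (c * s ^ (-δ)) / s) s := by
  have h := ((Real.hasDerivAt_rpow_const (p := -δ) (Or.inl hs.ne')).const_mul c).const_sub 1
  refine h.congr_deriv ?_
  rw [Real.rpow_sub_one hs.ne']
  ring

/-- First derivative of the barrier `s ↦ K (1 - c s ^ (-δ)) ^ (-m)`. -/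
lemma hasDerivAt_barrier (K c δ m : ℝ) {s : ℝ} (hs : 0 < s) (hd : 0 < 1 - c * s ^ (-δ)) :
    HasDerivAt (fun s : ℝ => K * (1 - c * s ^ (-δ)) ^ (-m))
      (K * (-(m * δ) * (1 - c * s ^ (-δ)) ^ (-m - 1) * ((c * s ^ (-δ)) / s))) s := by
  have h := ((hasDerivAt_barrierBase c δ hs).rpow_const (p := -m) (Or.inl hd.ne')).const_mul K
  refine h.congr_deriv ?_
  ring

/-- Second derivative of the barrier `s ↦ K (1 - c s ^ (-δ)) ^ (-m)`. -/
lemma hasDerivAt_deriv_barrier (K c δ m : ℝ) {s : ℝ} (hs : 0 < s) (hd : 0 < 1 - c * s ^ (-δ)) :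
    HasDerivAt
      (fun s : ℝ => K * (-(m * δ) * (1 - c * s ^ (-δ)) ^ (-m - 1) * ((c * s ^ (-δ)) / s)))
      (K * (1 - c * s ^ (-δ)) ^ (-m) / s ^ 2 *
        (m * (m + 1) * δ ^ 2 * (c * s ^ (-δ) / (1 - c * s ^ (-δ))) ^ 2 +
          m * δ * (δ + 1) * (c * s ^ (-δ) / (1 - c * s ^ (-δ))))) s := by
  have h1 := ((hasDerivAt_barrierBase c δ hs).rpow_const (p := -m - 1)
    (Or.inl hd.ne')).const_mul (-(m * δ))
  have h2 : HasDerivAt (fun s : ℝ => c * s ^ (-δ) / s)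
      (-(δ + 1) * (c * s ^ (-δ)) / s ^ 2) s := by
    have h := ((Real.hasDerivAt_rpow_const (p := -δ) (Or.inl hs.ne')).const_mul c).div
      (hasDerivAt_id s) hs.ne'
    refine h.congr_deriv ?_
    rw [Real.rpow_sub_one hs.ne']
    simp only [id]
    field_simp
    ring
  have h := (h1.mul h2).const_mul K
  refine h.congr_deriv ?_
  rw [Real.rpow_sub_one hd.ne', Real.rpow_sub_one hd.ne']
  generalize 1 - c * s ^ (-δ) = d at *
  field_simp
  ring

/-- The coefficient controlling the barrier; it tends to `0` with `δ`. -/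
def barrierCoeff (ρ lam τ m δ : ℝ) : ℝ :=
  4 * (m * (m + 1) * δ ^ 2 + m * δ * (δ + 1)) + |4 - 4 * ρ| * (m * δ) +
    |lam| * (2 * m * δ) ^ (1 - τ)

lemma tendsto_barrierCoeff (ρ lam τ m : ℝ) (hτ : τ < 1) :
    Tendsto (barrierCoeff ρ lam τ m) (𝓝 0) (𝓝 0) := by
  have hc : ContinuousAt (barrierCoeff ρ lam τ m) 0 := by
    unfold barrierCoeff
    have : ContinuousAt (fun δ : ℝ => (2 * m * δ) ^ (1 - τ)) 0 :=
      ContinuousAt.rpow_const (by fun_prop) (Or.inr (by linarith))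
    fun_prop
  have h0 : barrierCoeff ρ lam τ m 0 = 0 := by
    simp [barrierCoeff, Real.zero_rpow (by linarith : (1 - τ) ≠ 0)]
  simpa [ContinuousAt, h0] using hc

/-- The algebraic estimate at a touching point: `a`, `b` are the first and second derivatives at `n ^ 2` of the
barrier `H`, whose value is `U`, and `z = 1 - d`. -/
lemma pow_mul_sq_le_barrierCoeff {M ρ lam τ θ q m δ n U z d a b L : ℝ} (hτ0 : 0 ≤ τ) (hτ1 : τ < 1)
    (hm : 0 < m) (hδ : 0 < δ) (hn : 0 < n) (hU : 0 < U) (hz : 0 ≤ z) (hd : 0 < d)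
    (hzd : z + d = 1) (ha : a = -(m * δ * U * (z / d)) / n ^ 2)
    (hb : b = U / n ^ 4 * (m * (m + 1) * δ ^ 2 * (z / d) ^ 2 + m * δ * (δ + 1) * (z / d)))
    (hL : L ≤ 4 * n ^ 2 * b + 2 * M * a)
    (heq : L - (M - 2 + 2 * ρ) * (2 * a) + lam * (U ^ τ * (2 * |a| * n) ^ (1 - τ) / n ^ (1 + τ))
      = n ^ θ * U ^ q) :
    U ^ (q - 1) * d ^ 2 ≤ barrierCoeff ρ lam τ m δ * n ^ (-θ - 2) := by
  have hn2 : 0 < n ^ 2 := by positivity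
  set y := z / d with hy
  have hy0 : 0 ≤ y := by positivity
  have hd1 : d ≤ 1 := by linarith
  have hyd : y * d = z := by rw [hy]; field_simp
  have hyd1 : y * d ≤ 1 := by rw [hyd]; linarith
  have hyd2 : y * d ^ 2 ≤ 1 := by nlinarith
  have hyyd2 : y ^ 2 * d ^ 2 ≤ 1 := by
    rw [← mul_pow]; exact pow_le_one₀ (by positivity) hyd1
  have hgrad : n ^ 2 * (U ^ τ * (2 * |a| * n) ^ (1 - τ) / n ^ (1 + τ)) =
      U * ((2 * m * δ) ^ (1 - τ) * y ^ (1 - τ)) := by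
    have h1 : 2 * |a| * n = 2 * m * δ * y * U / n := by
      rw [ha, neg_div, abs_neg, abs_of_nonneg (by positivity)]
      field_simp
    rw [h1, Real.div_rpow (by positivity) hn.le, Real.mul_rpow (by positivity) hU.le,
      Real.mul_rpow (by positivity) hy0]
    have h2 : n ^ (1 - τ) * n ^ (1 + τ) = n ^ 2 := by
      rw [← Real.rpow_add hn, ← Real.rpow_natCast]; congr 1; push_cast; ring
    have h3 : U ^ τ * U ^ (1 - τ) = U := by
      rw [← Real.rpow_add hU]; simp
    have h4 : 0 < n ^ (1 - τ) := Real.rpow_pos_of_pos hn _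
    have h5 : 0 < n ^ (1 + τ) := Real.rpow_pos_of_pos hn _
    calc _ = n ^ 2 / (n ^ (1 - τ) * n ^ (1 + τ)) * (U ^ τ * U ^ (1 - τ)) *
          ((2 * m * δ) ^ (1 - τ) * y ^ (1 - τ)) := by field_simp
      _ = _ := by rw [h2, h3, div_self hn2.ne', one_mul]
  have hypow : y ^ (1 - τ) * d ^ 2 ≤ 1 := by
    have h1 : d ^ 2 ≤ d ^ (1 - τ) := by
      rw [← Real.rpow_natCast]
      exact Real.rpow_le_rpow_of_exponent_ge hd hd1 (by push_cast; linarith)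
    calc y ^ (1 - τ) * d ^ 2 ≤ y ^ (1 - τ) * d ^ (1 - τ) := by gcongr
      _ = (y * d) ^ (1 - τ) := (Real.mul_rpow hy0 hd.le).symm
      _ ≤ 1 := Real.rpow_le_one (by positivity) hyd1 (by linarith)
  have hna : n ^ 2 * a = -(m * δ * U * y) := by rw [ha]; field_simp
  have hnb : n ^ 4 * b = U * (m * (m + 1) * δ ^ 2 * y ^ 2 + m * δ * (δ + 1) * y) := by
    rw [hb]; field_simp
  set C := (2 * m * δ) ^ (1 - τ) with hC
  have hC0 : 0 ≤ C := by positivity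
  have hmul : n ^ 2 * (n ^ θ * U ^ q) ≤
      4 * (n ^ 4 * b) + (4 - 4 * ρ) * (n ^ 2 * a) + lam * (U * (C * y ^ (1 - τ))) := by
    rw [← heq, ← hgrad]
    nlinarith [mul_le_mul_of_nonneg_left hL hn2.le]
  have hmain : n ^ 2 * (n ^ θ * U ^ q) * d ^ 2 ≤ U * barrierCoeff ρ lam τ m δ := by
    have hA : (4 - 4 * ρ) * (n ^ 2 * a) * d ^ 2 ≤ U * (|4 - 4 * ρ| * (m * δ)) := by
      calc (4 - 4 * ρ) * (n ^ 2 * a) * d ^ 2 = -(4 - 4 * ρ) * (U * (m * δ) * (y * d ^ 2)) := by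
            rw [hna]; ring
        _ ≤ |4 - 4 * ρ| * (U * (m * δ) * 1) := by
            gcongr
            exact neg_le_abs _
        _ = _ := by ring
    have hB : lam * (U * (C * y ^ (1 - τ))) * d ^ 2 ≤ U * (|lam| * C) := by
      calc lam * (U * (C * y ^ (1 - τ))) * d ^ 2 = lam * (U * C * (y ^ (1 - τ) * d ^ 2)) := by ring
        _ ≤ |lam| * (U * C * 1) := by
            gcongr
            exact le_abs_self _
        _ = _ := by ring
    have hD : 4 * (n ^ 4 * b) * d ^ 2 ≤
        U * (4 * (m * (m + 1) * δ ^ 2 + m * δ * (δ + 1))) := by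
      calc 4 * (n ^ 4 * b) * d ^ 2 = U * (4 * (m * (m + 1) * δ ^ 2 * (y ^ 2 * d ^ 2) +
            m * δ * (δ + 1) * (y * d ^ 2))) := by rw [hnb]; ring
        _ ≤ U * (4 * (m * (m + 1) * δ ^ 2 * 1 + m * δ * (δ + 1) * 1)) := by gcongr
        _ = _ := by ring
    have := mul_le_mul_of_nonneg_right hmul (sq_nonneg d)
    unfold barrierCoeff
    linarith
  have hUq : U ^ q = U ^ (q - 1) * U := by rw [Real.rpow_sub_one hU.ne']; field_simp
  have hnn : n ^ 2 * n ^ θ * n ^ (-θ - 2) = 1 := by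
    rw [← Real.rpow_natCast, ← Real.rpow_add hn, ← Real.rpow_add hn]
    ring_nf
    exact Real.rpow_zero n
  have hP : 0 < n ^ (-θ - 2) := Real.rpow_pos_of_pos hn _
  have hfin : n ^ 2 * n ^ θ * (U ^ (q - 1) * d ^ 2) ≤ barrierCoeff ρ lam τ m δ := by
    refine le_of_mul_le_mul_left ?_ hU
    calc _ = n ^ 2 * (n ^ θ * U ^ q) * d ^ 2 := by rw [hUq]; ring
      _ ≤ _ := hmain
  calc U ^ (q - 1) * d ^ 2
      = n ^ 2 * n ^ θ * (U ^ (q - 1) * d ^ 2) * n ^ (-θ - 2) := by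
        rw [mul_right_comm, hnn, one_mul]
    _ ≤ _ := by gcongr

/-- Barrier estimate at a fixed parameter `δ` and a fixed point `x₀`. -/
lemma rpow_le_barrierCoeff_of_solution
    {N : ℕ} {ρ lam τ θ q : ℝ} (hτ0 : 0 ≤ τ) (hτ1 : τ < 1) (hq : 1 < q)
    {Ω : Set (EuclideanSpace ℝ (Fin N))} (hΩo : IsOpen Ω) {R : ℝ}
    (hR : ∀ x ∈ closure Ω, ‖x‖ ≤ R) (hθ : θ ≤ -2)
    {u : EuclideanSpace ℝ (Fin N) → ℝ} (hu : ContDiffOn ℝ 2 u (Ω \ {0}))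
    (huc : ContinuousOn u (closure Ω \ {0})) (hpos : ∀ x ∈ Ω \ {0}, 0 < u x)
    (heq : ∀ x ∈ Ω \ {0},
      lapl u x - ((N : ℝ) - 2 + 2 * ρ) * (⟪x, gradient u x⟫ / ‖x‖ ^ 2)
        + lam * (u x ^ τ * ‖gradient u x‖ ^ (1 - τ) / ‖x‖ ^ (1 + τ)) = ‖x‖ ^ θ * u x ^ q)
    (hbd : ∀ x ∈ frontier Ω, u x = 0) {x₀ : EuclideanSpace ℝ (Fin N)} (hx₀ : x₀ ∈ Ω \ {0})
    {δ : ℝ} (hδ : 0 < δ) :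
    (u x₀ * (1 / 2) ^ (2 / (q - 1))) ^ (q - 1) ≤
      barrierCoeff ρ lam τ (2 / (q - 1)) δ * R ^ (-θ - 2) := by
  set m : ℝ := 2 / (q - 1) with hm_def
  have hq1 : 0 < q - 1 := by linarith
  have hm : 0 < m := by positivity
  have hn₀ : 0 < ‖x₀‖ := norm_pos_iff.2 hx₀.2
  set c : ℝ := (‖x₀‖ ^ 2) ^ δ / 2 with hc_def
  have hc : 0 < c := by positivity
  set D : EuclideanSpace ℝ (Fin N) → ℝ := fun x => 1 - c * (‖x‖ ^ 2) ^ (-δ) with hD_def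
  set T : Set (EuclideanSpace ℝ (Fin N)) := closure Ω ∩ {x | c ≤ (‖x‖ ^ 2) ^ δ} with hT_def
  have hTne : ∀ x ∈ T, x ≠ 0 := by
    rintro x ⟨-, hx⟩ rfl
    simp [Real.zero_rpow hδ.ne'] at hx
    linarith
  have hTc : IsCompact T := by
    have hcl : IsCompact (closure Ω) :=
      (isCompact_closedBall (0 : EuclideanSpace ℝ (Fin N)) R).of_isClosed_subset isClosed_closure
        fun x hx => by simpa using hR x hx
    refine hcl.inter_right (isClosed_le continuous_const ?_)
    exact Continuous.rpow_const (by fun_prop) fun _ => Or.inr hδ.le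
  have hDnonneg : ∀ x, x ≠ 0 → (0 ≤ D x ↔ c ≤ (‖x‖ ^ 2) ^ δ) := fun x hx => by
    have : 0 < (‖x‖ ^ 2) ^ δ := Real.rpow_pos_of_pos (by positivity) _
    simp only [hD_def]
    rw [Real.rpow_neg (by positivity), sub_nonneg, ← div_eq_mul_inv, div_le_one this]
  have hDcont : ∀ x, x ≠ 0 → ContinuousAt D x := fun x hx => by
    have : ContinuousAt (fun x : EuclideanSpace ℝ (Fin N) => (‖x‖ ^ 2) ^ (-δ)) x :=
      ContinuousAt.rpow_const (by fun_prop) (Or.inl (by positivity))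
    simp only [hD_def]
    fun_prop
  have hDx₀ : D x₀ = 1 / 2 := by
    have : 0 < (‖x₀‖ ^ 2) ^ δ := by positivity
    simp only [hD_def, hc_def]
    rw [Real.rpow_neg (by positivity)]
    field_simp
    norm_num
  have hx₀T : x₀ ∈ T :=
    ⟨subset_closure hx₀.1, (hDnonneg x₀ hx₀.2).1 (by rw [hDx₀]; norm_num)⟩
  have hWc : ContinuousOn (fun x => u x * D x ^ m) T := by
    refine (huc.mono fun x hx => ⟨hx.1, hTne x hx⟩).mul fun x hx => ?_
    exact ((hDcont x (hTne x hx)).rpow_const (Or.inr hm.le)).continuousWithinAt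
  obtain ⟨p, hpT, hpmax⟩ := hTc.exists_isMaxOn ⟨x₀, hx₀T⟩ hWc
  have hle : u x₀ * (1 / 2) ^ m ≤ u p * D p ^ m := by
    have := hpmax hx₀T
    simpa [hDx₀] using this
  have hu₀ : 0 < u x₀ * (1 / 2) ^ m := mul_pos (hpos x₀ hx₀) (by positivity)
  have hWp : 0 < u p * D p ^ m := hu₀.trans_le hle
  have hp0 : p ≠ 0 := hTne p hpT
  have hn : 0 < ‖p‖ := norm_pos_iff.2 hp0
  have hpΩ : p ∈ Ω := by
    by_contra hp
    have : u p = 0 := hbd p ⟨hpT.1, by rwa [hΩo.interior_eq]⟩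
    simp [this] at hWp
  have hpΩ0 : p ∈ Ω \ {0} := ⟨hpΩ, hp0⟩
  have hDp : 0 < D p := by
    refine lt_of_le_of_ne ((hDnonneg p hp0).2 hpT.2) fun h => ?_
    simp [← h, Real.zero_rpow hm.ne'] at hWp
  have hopen : IsOpen (Ω \ {0}) := hΩo.sdiff isClosed_singleton
  have hup := hpos p hpΩ0
  set K := u p * D p ^ m with hK_def
  have hDpm : D p ^ m * D p ^ (-m) = 1 := by rw [← Real.rpow_add hDp]; simp
  have hKp : K * D p ^ (-m) = u p := by rw [hK_def, mul_assoc, hDpm, mul_one]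
  have htouch : ∀ᶠ x in 𝓝 p, u x ≤ K * (1 - c * (‖x‖ ^ 2) ^ (-δ)) ^ (-m) := by
    filter_upwards [hopen.mem_nhds hpΩ0, (hDcont p hp0).eventually (lt_mem_nhds hDp)] with x hx hDx
    have h1 : u x * D x ^ m ≤ K :=
      hpmax ⟨subset_closure hx.1, (hDnonneg x hx.2).1 hDx.le⟩
    have h2 : D x ^ m * D x ^ (-m) = 1 := by rw [← Real.rpow_add hDx]; simp
    calc u x = u x * D x ^ m * D x ^ (-m) := by rw [mul_assoc, h2, mul_one]
      _ ≤ K * D x ^ (-m) := by gcongr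
  have hS : 0 < ‖p‖ ^ 2 := by positivity
  have hderiv : ∀ᶠ s in 𝓝 (‖p‖ ^ 2), HasDerivAt (fun s : ℝ => K * (1 - c * s ^ (-δ)) ^ (-m))
      (K * (-(m * δ) * (1 - c * s ^ (-δ)) ^ (-m - 1) * ((c * s ^ (-δ)) / s))) s := by
    filter_upwards [lt_mem_nhds hS, (hasDerivAt_barrierBase c δ hS).continuousAt.eventually
      (lt_mem_nhds hDp)] with s hs hds using hasDerivAt_barrier K c δ m hs hds
  obtain ⟨hgrad, hlapl⟩ := gradient_eq_and_lapl_le_of_radial_touching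
    (hu.contDiffAt (hopen.mem_nhds hpΩ0)) hderiv (hasDerivAt_deriv_barrier K c δ m hS hDp)
    hKp.symm htouch
  have hE := heq p hpΩ0
  rw [hgrad, real_inner_smul_right, real_inner_self_eq_norm_sq, mul_div_assoc, div_self hS.ne',
    mul_one, norm_smul, Real.norm_eq_abs, abs_mul, abs_two] at hE
  have hest := pow_mul_sq_le_barrierCoeff (z := c * (‖p‖ ^ 2) ^ (-δ)) (d := D p) hτ0 hτ1 hm hδ hn
    hup (by positivity) hDp (by simp only [hD_def]; ring) (by
      change K * (-(m * δ) * D p ^ (-m - 1) * _) = _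
      rw [Real.rpow_sub_one hDp.ne', ← hKp]
      ring) (by
      change K * D p ^ (-m) / _ * _ = _
      rw [hKp, ← pow_mul]) hlapl hE
  have hA : 0 ≤ barrierCoeff ρ lam τ m δ := by
    unfold barrierCoeff
    positivity
  calc (u x₀ * (1 / 2) ^ m) ^ (q - 1) ≤ K ^ (q - 1) := by gcongr
    _ = u p ^ (q - 1) * D p ^ 2 := by
        rw [hK_def, Real.mul_rpow hup.le (by positivity), ← Real.rpow_mul hDp.le, hm_def,
          div_mul_cancel₀ _ hq1.ne', Real.rpow_two]
    _ ≤ barrierCoeff ρ lam τ m δ * ‖p‖ ^ (-θ - 2) := hest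
    _ ≤ barrierCoeff ρ lam τ m δ * R ^ (-θ - 2) := by
        gcongr
        · linarith
        · exact hR p hpT.1

/-- On a bounded domain `Ω ∋ 0` with `θ ≤ -2`, there is no positive function
`u`, of class `C²` on `Ω \ {0}` and continuous on `(closure Ω) \ {0}`, solving (E)
pointwise in `Ω \ {0}` and vanishing on `∂Ω`. -/
theorem stmt15_no_dirichlet_solution
    (N : ℕ) (hN : 2 ≤ N) (ρ lam τ θ q : ℝ)
    (hτ0 : 0 ≤ τ) (hτ1 : τ < 1) (hq : 1 < q)
    (Ω : Set (EuclideanSpace ℝ (Fin N))) (hΩo : IsOpen Ω) (hΩc : IsConnected Ω)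
    (hΩb : Bornology.IsBounded Ω) (h0 : (0 : EuclideanSpace ℝ (Fin N)) ∈ Ω)
    (hθ : θ ≤ -2) :
    ¬ ∃ u : EuclideanSpace ℝ (Fin N) → ℝ,
        ContDiffOn ℝ 2 u (Ω \ {0}) ∧
        ContinuousOn u (closure Ω \ {0}) ∧
        (∀ x ∈ Ω \ {0}, 0 < u x) ∧
        (∀ x ∈ Ω \ {0},
          lapl u x - ((N : ℝ) - 2 + 2 * ρ) * (⟪x, gradient u x⟫ / ‖x‖ ^ 2)
            + lam * (u x ^ τ * ‖gradient u x‖ ^ (1 - τ) / ‖x‖ ^ (1 + τ))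
            = ‖x‖ ^ θ * u x ^ q) ∧
        (∀ x ∈ frontier Ω, u x = 0) := by
  rintro ⟨u, hu, huc, hpos, heq, hbd⟩
  have : NeZero N := ⟨by omega⟩
  obtain ⟨x₀, hx₀⟩ : (Ω \ {0}).Nonempty := by
    have h := mem_nhdsWithin_of_mem_nhds (t := {0}ᶜ) (hΩo.mem_nhds h0)
    exact Filter.nonempty_of_mem (inter_mem h self_mem_nhdsWithin)
  obtain ⟨R, hR⟩ := hΩb.closure.exists_norm_le
  have hlim : Tendsto (fun δ => barrierCoeff ρ lam τ (2 / (q - 1)) δ * R ^ (-θ - 2))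
      (𝓝[>] 0) (𝓝 0) := by
    simpa using ((tendsto_barrierCoeff ρ lam τ (2 / (q - 1)) hτ1).mono_left
      nhdsWithin_le_nhds).mul_const (R ^ (-θ - 2))
  have hle : (u x₀ * (1 / 2) ^ (2 / (q - 1))) ^ (q - 1) ≤ 0 := by
    refine ge_of_tendsto hlim ?_
    filter_upwards [self_mem_nhdsWithin] with δ hδ
    exact rpow_le_barrierCoeff_of_solution hτ0 hτ1 hq hΩo hR hθ hu huc hpos heq hbd hx₀ hδ
  have := hpos x₀ hx₀
  exact absurd hle (not_le.2 (by positivity))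

end
end

section
/- Set λ⁺ = max(λ, 0) and C₀ = 2^{|θ|/(q−1)} [ (16/(q−1)) ( 2(q+1)/(q−1) + N + |N−2+2ρ| + (1−τ)λ⁺ ) + 4τλ⁺ ]^{1/(q−1)}. Let r₀ > 0 be such that the closed ball of radius 2r₀ centered at 0 is contained in Ω. Then every positive sub-solution u of equation (E) in Ω∖{0} satisfies u(x) ≤ C₀ |x|^{−β} for all x with 0 < |x| ≤ r₀. -/
open MeasureTheory Filter Topology Real RealInnerProductSpace

noncomputable section

/-- The square of the positive part is differentiable on `ℝ`. -/
lemma hasDerivAt_max_zero_sq (t : ℝ) :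
    HasDerivAt (fun s : ℝ => (max s 0) ^ 2) (2 * max t 0) t := by
  rcases lt_trichotomy t 0 with ht | rfl | ht
  · have : (fun s : ℝ => (max s 0) ^ 2) =ᶠ[𝓝 t] fun _ => 0 := by
      filter_upwards [Iio_mem_nhds ht] with s hs
      simp [max_eq_right (le_of_lt (Set.mem_Iio.1 hs))]
    rw [max_eq_right ht.le, mul_zero]
    exact (hasDerivAt_const t (0 : ℝ)).congr_of_eventuallyEq this
  · rw [hasDerivAt_iff_isLittleO]
    have hO : (fun s : ℝ => s ^ 2) =o[𝓝 0] fun s : ℝ => s := by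
      simpa using Asymptotics.isLittleO_pow_id (𝕜 := ℝ) (n := 2) one_lt_two
    refine (Asymptotics.IsBigO.of_bound 1 (Eventually.of_forall fun s => ?_)).trans_isLittleO
      (by simpa using hO)
    rcases le_total s 0 with hs | hs <;> simp [hs, sq_nonneg]
  · have : (fun s : ℝ => (max s 0) ^ 2) =ᶠ[𝓝 t] fun s => s ^ 2 := by
      filter_upwards [Ioi_mem_nhds ht] with s hs
      simp [max_eq_left (le_of_lt (Set.mem_Ioi.1 hs))]
    rw [max_eq_left ht.le]
    simpa using (hasDerivAt_pow 2 t).congr_of_eventuallyEq this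

lemma contDiff_max_zero_sq : ContDiff ℝ 1 fun s : ℝ => (max s 0) ^ 2 := by
  rw [contDiff_one_iff_deriv]
  refine ⟨fun t => (hasDerivAt_max_zero_sq t).differentiableAt, ?_⟩
  rw [funext fun t => (hasDerivAt_max_zero_sq t).deriv]
  fun_prop

/-- Second-order Taylor bound: a function with second derivative `c` at `0` lies locally below
its second-order Taylor polynomial with `c` slightly increased. -/
lemma eventually_le_taylor_two {g g' : ℝ → ℝ} {c ε : ℝ} (hε : 0 < ε)
    (hg : ∀ᶠ t in 𝓝 0, HasDerivAt g (g' t) t) (hg' : HasDerivAt g' c 0) :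
    ∀ᶠ t in 𝓝 0, g t ≤ g 0 + g' 0 * t + (c / 2 + ε) * t ^ 2 := by
  set k : ℝ → ℝ := fun t => g 0 + g' 0 * t + (c / 2 + ε) * t ^ 2 - g t with hk
  have hd : ∀ᶠ t in 𝓝 0, HasDerivAt k (g' 0 + (c + 2 * ε) * t - g' t) t := by
    filter_upwards [hg] with t ht
    have := ((((hasDerivAt_id t).const_mul (g' 0)).const_add (g 0)).add
      ((hasDerivAt_pow 2 t).const_mul (c / 2 + ε))).sub ht
    refine this.congr_deriv ?_
    norm_num
    ring
  have hd' : deriv k =ᶠ[𝓝 0] fun t => g' 0 + (c + 2 * ε) * t - g' t := by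
    filter_upwards [hd] with t ht using ht.deriv
  have hdd : deriv (deriv k) 0 = 2 * ε := by
    rw [hd'.deriv_eq]
    have : HasDerivAt (fun t => g' 0 + (c + 2 * ε) * t - g' t) ((c + 2 * ε) * 1 - c) 0 :=
      (((hasDerivAt_id (0 : ℝ)).const_mul (c + 2 * ε)).const_add (g' 0)).sub hg'
    rw [this.deriv]
    ring
  have hmin : IsLocalMin k 0 := by
    refine isLocalMin_of_deriv_deriv_pos (by rw [hdd]; positivity) ?_
      hd.self_of_nhds.continuousAt
    rw [hd.self_of_nhds.deriv]; ring
  filter_upwards [hmin] with t ht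
  simp only [hk] at ht
  linarith

section Quadratic

variable {E : Type*} [NormedAddCommGroup E] [InnerProductSpace ℝ E]

/-- A quadratic polynomial centred at `y`. -/
def quadPoly (a : ℝ) (b : E) (c d : ℝ) (e y x : E) : ℝ :=
  a + ⟪b, x - y⟫ + c * ‖x - y‖ ^ 2 + d * ⟪e, x - y⟫ ^ 2

/-- The gradient of `quadPoly a b c d e y`. -/
def quadGrad (b : E) (c d : ℝ) (e y x : E) : E :=
  b + (2 * c) • (x - y) + (2 * d * ⟪e, x - y⟫) • e

lemma contDiff_quadPoly (a : ℝ) (b : E) (c d : ℝ) (e y : E) :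
    ContDiff ℝ 1 (quadPoly a b c d e y) := by
  unfold quadPoly
  have h : ContDiff ℝ 1 fun x : E => x - y := contDiff_id.sub contDiff_const
  exact ((contDiff_const.add (contDiff_const.inner ℝ h)).add
    (contDiff_const.mul (h.norm_sq ℝ))).add (contDiff_const.mul ((contDiff_const.inner ℝ h).pow 2))

lemma continuous_quadGrad (b : E) (c d : ℝ) (e y : E) : Continuous (quadGrad b c d e y) := by
  unfold quadGrad
  fun_prop

lemma hasGradientAt_quadPoly [CompleteSpace E] (a : ℝ) (b : E) (c d : ℝ) (e y x : E) :
    HasGradientAt (quadPoly a b c d e y) (quadGrad b c d e y x) x := by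
  rw [hasGradientAt_iff_hasFDerivAt]
  have h : HasFDerivAt (fun x : E => x - y) (ContinuousLinearMap.id ℝ E) x :=
    (hasFDerivAt_id x).sub_const y
  have hi : ∀ v : E, HasFDerivAt (fun x : E => ⟪v, x - y⟫) (innerSL ℝ v) x := fun v =>
    (innerSL ℝ v).hasFDerivAt.comp x h
  have := (((hi b).const_add a).add (h.norm_sq.const_mul c)).add (((hi e).pow 2).const_mul d)
  refine this.congr_fderiv ?_
  ext v
  simp [quadGrad]
  ring

variable [FiniteDimensional ℝ E] [MeasurableSpace E] [BorelSpace E]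

lemma integral_inner_sub_mul_fderiv (μ : Measure E) [μ.IsAddHaarMeasure] {φ : E → ℝ}
    (hφ : ContDiff ℝ 1 φ) (hc : HasCompactSupport φ) (a : ℝ) (e y v : E) :
    ∫ x, (a + ⟪e, x - y⟫) * fderiv ℝ φ x v ∂μ = -(⟪e, v⟫ * ∫ x, φ x ∂μ) := by
  have hd : ∀ x, HasFDerivAt (fun x : E => a + ⟪e, x - y⟫) (innerSL ℝ e) x := fun x =>
    ((innerSL ℝ e).hasFDerivAt.comp x ((hasFDerivAt_id x).sub_const y)).const_add a
  have hcont : Continuous fun x => fderiv ℝ φ x v :=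
    (hφ.continuous_fderiv one_ne_zero).clm_apply continuous_const
  rw [integral_mul_fderiv_eq_neg_fderiv_mul_of_integrable]
  · simp only [fun x => (hd x).fderiv, innerSL_apply_apply]
    rw [integral_const_mul]
  · simp only [fun x => (hd x).fderiv, innerSL_apply_apply]
    exact (continuous_const.mul hφ.continuous).integrable_of_hasCompactSupport hc.mul_left
  · exact Continuous.integrable_of_hasCompactSupport (by fun_prop) (hc.fderiv_apply ℝ v).mul_left
  · have := hφ.continuous
    exact Continuous.integrable_of_hasCompactSupport (by fun_prop) hc.mul_left
  · exact fun x _ => (hd x).differentiableAt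
  · exact fun x _ => hφ.differentiable one_ne_zero x

/-- Integration by parts of a quadratic polynomial against a test function. -/
lemma integral_inner_quadGrad_gradient (μ : Measure E) [μ.IsAddHaarMeasure] {φ : E → ℝ}
    (hφ : ContDiff ℝ 1 φ) (hc : HasCompactSupport φ) (b : E) (c d : ℝ) (e y : E) :
    ∫ x, ⟪quadGrad b c d e y x, gradient φ x⟫ ∂μ
      = -((2 * c * Module.finrank ℝ E + 2 * d * ‖e‖ ^ 2) * ∫ x, φ x ∂μ) := by
  set B := stdOrthonormalBasis ℝ E
  have hcont : ∀ v, Continuous fun x => fderiv ℝ φ x v := fun v =>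
    (hφ.continuous_fderiv one_ne_zero).clm_apply continuous_const
  have hint : ∀ (a : ℝ) (e v : E), Integrable (fun x => (a + ⟪e, x - y⟫) * fderiv ℝ φ x v) μ :=
    fun a e v => Continuous.integrable_of_hasCompactSupport
      (by have := hcont v; fun_prop) (hc.fderiv_apply ℝ v).mul_left
  have hpt : ∀ x, ⟪quadGrad b c d e y x, gradient φ x⟫
      = (1 + ⟪(0 : E), x - y⟫) * fderiv ℝ φ x b
        + 2 * c * ∑ i, (0 + ⟪B i, x - y⟫) * fderiv ℝ φ x (B i)
        + 2 * d * ((0 + ⟪e, x - y⟫) * fderiv ℝ φ x e) := by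
    intro x
    have h1 : ∀ v, ⟪v, gradient φ x⟫ = fderiv ℝ φ x v := fun v => by
      rw [inner_gradient_right]; simp
    have h2 : fderiv ℝ φ x (x - y) = ∑ i, (0 + ⟪B i, x - y⟫) * fderiv ℝ φ x (B i) := by
      conv_lhs => rw [← B.sum_repr' (x - y)]
      simp
    simp only [quadGrad, h1, ← h2]
    simp
    ring
  simp_rw [hpt]
  rw [integral_add, integral_add, integral_const_mul, integral_const_mul, integral_finsetSum]
  · simp only [integral_inner_sub_mul_fderiv μ hφ hc]
    simp [B.norm_eq_one]
    ring
  · exact fun i _ => hint _ _ _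
  · exact hint _ _ _
  · exact (integrable_finsetSum _ fun i _ => hint _ _ _).const_mul _
  · exact (hint _ _ _).add ((integrable_finsetSum _ fun i _ => hint _ _ _).const_mul _)
  · exact (hint _ _ _).const_mul _

end Quadratic

lemma ContDiffOn.continuousOn_gradient {E : Type*} [NormedAddCommGroup E] [InnerProductSpace ℝ E]
    [CompleteSpace E] {u : E → ℝ} {s : Set E} (hs : IsOpen s) (hu : ContDiffOn ℝ 1 u s) :
    ContinuousOn (gradient u) s :=
  (InnerProductSpace.toDual ℝ E).symm.continuous.comp_continuousOn
    (hu.continuousOn_fderiv_of_isOpen hs le_rfl)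

lemma gradient_of_notMem_tsupport {E : Type*} [NormedAddCommGroup E] [InnerProductSpace ℝ E]
    [CompleteSpace E] {φ : E → ℝ} {x : E} (hx : x ∉ tsupport φ) : gradient φ x = 0 := by
  simp [gradient, fderiv_of_notMem_tsupport ℝ hx]

/-- A function continuous on an open set `s` which vanishes outside a compact subset of `s`
is continuous with compact support. -/
lemma ContinuousOn.continuous_and_hasCompactSupport {X : Type*} [TopologicalSpace X] [T2Space X]
    {h : X → ℝ} {s K : Set X} (hs : IsOpen s) (hh : ContinuousOn h s) (hK : IsCompact K)
    (hKs : K ⊆ s) (h0 : ∀ x ∉ K, h x = 0) : Continuous h ∧ HasCompactSupport h := by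
  have hsub : tsupport h ⊆ K :=
    closure_minimal (fun x hx => by_contra fun hxK => hx (h0 x hxK)) hK.isClosed
  exact ⟨hh.continuous_of_tsupport_subset hs (hsub.trans hKs), HasCompactSupport.intro hK h0⟩

/-- The terms of equation (E) of order at most one, evaluated along `u`. -/
def lowerTerms {N : ℕ} (ρ lam τ θ q : ℝ) (u : EuclideanSpace ℝ (Fin N) → ℝ)
    (x : EuclideanSpace ℝ (Fin N)) : ℝ :=
  ((N : ℝ) - 2 + 2 * ρ) * (⟪x, gradient u x⟫ / ‖x‖ ^ 2)
    - lam * Gt τ x (u x) (gradient u x) + ‖x‖ ^ θ * u x ^ q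

section Continuity

variable {N : ℕ} {Ω : Set (EuclideanSpace ℝ (Fin N))} {u : EuclideanSpace ℝ (Fin N) → ℝ}

lemma PosC1.continuousOn_drift (hΩ : IsOpen Ω) (hu : PosC1 Ω u) :
    ContinuousOn (fun x => ⟪x, gradient u x⟫ / ‖x‖ ^ 2) (Ω \ {0}) := by
  have hS : IsOpen (Ω \ {0}) := hΩ.sdiff isClosed_singleton
  refine (continuousOn_id.inner (hu.1.continuousOn_gradient hS)).div (by fun_prop) fun x hx => ?_
  exact pow_ne_zero 2 (norm_ne_zero_iff.2 hx.2)

lemma PosC1.continuousOn_Gt {τ : ℝ} (hτ : τ < 1) (hΩ : IsOpen Ω) (hu : PosC1 Ω u) :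
    ContinuousOn (fun x => Gt τ x (u x) (gradient u x)) (Ω \ {0}) := by
  have hS : IsOpen (Ω \ {0}) := hΩ.sdiff isClosed_singleton
  refine ((hu.1.continuousOn.rpow_const fun x hx => .inl (hu.2 x hx).ne').mul
    ((hu.1.continuousOn_gradient hS).norm.rpow_const fun x _ => .inr (by linarith))).div
    (continuousOn_id.norm.rpow_const fun x hx => .inl (norm_ne_zero_iff.2 hx.2)) fun x hx => ?_
  exact (rpow_pos_of_pos (norm_pos_iff.2 hx.2) _).ne'

lemma PosC1.continuousOn_absorption (θ q : ℝ) (hu : PosC1 Ω u) :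
    ContinuousOn (fun x => ‖x‖ ^ θ * u x ^ q) (Ω \ {0}) :=
  (continuousOn_id.norm.rpow_const fun _ hx => .inl (norm_ne_zero_iff.2 hx.2)).mul
    (hu.1.continuousOn.rpow_const fun x hx => .inl (hu.2 x hx).ne')

lemma PosC1.continuousOn_lowerTerms {τ : ℝ} (ρ lam θ q : ℝ) (hτ : τ < 1) (hΩ : IsOpen Ω)
    (hu : PosC1 Ω u) : ContinuousOn (lowerTerms ρ lam τ θ q u) (Ω \ {0}) :=
  ((continuousOn_const.mul (hu.continuousOn_drift hΩ)).sub
    (continuousOn_const.mul (hu.continuousOn_Gt hτ hΩ))).add (hu.continuousOn_absorption θ q)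

/-- The weak formulation as a single integral over the whole space. -/
lemma weakE_eq_integral {τ : ℝ} (ρ lam θ q : ℝ) (hτ : τ < 1) (hΩ : IsOpen Ω) (hu : PosC1 Ω u)
    {φ : EuclideanSpace ℝ (Fin N) → ℝ} (hφ : IsTestFun Ω φ) :
    weakE N ρ lam τ θ q Ω u φ
      = ∫ x, (⟪gradient u x, gradient φ x⟫ + lowerTerms ρ lam τ θ q u x * φ x) := by
  have hS : IsOpen (Ω \ {0}) := hΩ.sdiff isClosed_singleton
  have hφc := hφ.1.continuous.continuousOn (s := Ω \ {0})
  have key : ∀ h : EuclideanSpace ℝ (Fin N) → ℝ, ContinuousOn h (Ω \ {0}) →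
      (∀ x ∉ tsupport φ, h x = 0) → Integrable h ∧ ∫ x in Ω \ {0}, h x = ∫ x, h x := by
    intro h hc h0
    obtain ⟨h1, h2⟩ := hc.continuous_and_hasCompactSupport hS hφ.2.1 hφ.2.2 h0
    exact ⟨h1.integrable_of_hasCompactSupport h2,
      setIntegral_eq_integral_of_forall_compl_eq_zero fun x hx => h0 x fun hx' => hx (hφ.2.2 hx')⟩
  have hφ0 : ∀ x ∉ tsupport φ, φ x = 0 := fun x hx => image_eq_zero_of_notMem_tsupport hx
  obtain ⟨i1, e1⟩ := key (fun x => ⟪gradient u x, gradient φ x⟫)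
    ((hu.1.continuousOn_gradient hS).inner (hφ.1.contDiffOn.continuousOn_gradient hS))
    fun x hx => by simp [gradient_of_notMem_tsupport hx]
  obtain ⟨i2, e2⟩ := key (fun x => ⟪x, gradient u x⟫ / ‖x‖ ^ 2 * φ x)
    ((hu.continuousOn_drift hΩ).mul hφc) fun x hx => by simp [hφ0 x hx]
  obtain ⟨i3, e3⟩ := key (fun x => Gt τ x (u x) (gradient u x) * φ x)
    ((hu.continuousOn_Gt hτ hΩ).mul hφc) fun x hx => by simp [hφ0 x hx]
  obtain ⟨i4, e4⟩ := key (fun x => ‖x‖ ^ θ * u x ^ q * φ x)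
    ((hu.continuousOn_absorption θ q).mul hφc) fun x hx => by simp [hφ0 x hx]
  have i12 : Integrable fun x => ⟪gradient u x, gradient φ x⟫
      + ((N : ℝ) - 2 + 2 * ρ) * (⟪x, gradient u x⟫ / ‖x‖ ^ 2 * φ x) := i1.add (i2.const_mul _)
  have i123 : Integrable fun x => ⟪gradient u x, gradient φ x⟫
      + ((N : ℝ) - 2 + 2 * ρ) * (⟪x, gradient u x⟫ / ‖x‖ ^ 2 * φ x)
      - lam * (Gt τ x (u x) (gradient u x) * φ x) := i12.sub (i3.const_mul _)
  rw [weakE, e1, e2, e3, e4, ← integral_const_mul, ← integral_const_mul, ← integral_add i1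
    (i2.const_mul _), ← integral_sub i12 (i3.const_mul _), ← integral_add i123 i4]
  refine integral_congr_ae (Eventually.of_forall fun x => ?_)
  simp only [lowerTerms]
  ring

end Continuity

/-- If a sub-solution is locally touched from above at `y` by a quadratic polynomial, strictly in
a quadratic sense, then the equation holds at `y` with the appropriate inequality. -/
lemma IsSubSolutionE.lowerTerms_le_of_strict {N : ℕ} {ρ lam τ θ q : ℝ} (hτ : τ < 1)
    {Ω : Set (EuclideanSpace ℝ (Fin N))} (hΩ : IsOpen Ω) {u : EuclideanSpace ℝ (Fin N) → ℝ}
    (hu : IsSubSolutionE N ρ lam τ θ q Ω u) {a c d ε : ℝ} {b e y : EuclideanSpace ℝ (Fin N)}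
    (hε : 0 < ε) (hy : y ∈ Ω \ {0}) (ha : u y = a)
    (htouch : ∀ᶠ x in 𝓝 y, u x ≤ quadPoly a b c d e y x - ε * ‖x - y‖ ^ 2) :
    lowerTerms ρ lam τ θ q u y ≤ 2 * c * N + 2 * d * ‖e‖ ^ 2 := by
  set m := 2 * c * N + 2 * d * ‖e‖ ^ 2 with hm
  by_contra! hlt
  have hS : IsOpen (Ω \ {0}) := hΩ.sdiff isClosed_singleton
  have hFc := hu.1.continuousOn_lowerTerms ρ lam θ q hτ hΩ
  have hF : ∀ᶠ x in 𝓝 y, m < lowerTerms ρ lam τ θ q u x :=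
    (hFc.continuousAt (hS.mem_nhds hy)).eventually (lt_mem_nhds hlt)
  obtain ⟨r, hr, hball⟩ := Metric.eventually_nhds_iff_ball.1
    ((htouch.and hF).and (hS.mem_nhds hy))
  set w : EuclideanSpace ℝ (Fin N) → ℝ := fun x =>
    u x - quadPoly a b c d e y x + ε * (r / 2) ^ 2 with hw
  have hwy : w y = ε * (r / 2) ^ 2 := by simp [hw, quadPoly, ha]
  set φ : EuclideanSpace ℝ (Fin N) → ℝ :=
    (Metric.ball y r).indicator fun x => (max (w x) 0) ^ 2 with hφ
  set K := Metric.closedBall y (r / 2) with hK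
  have hKr : K ⊆ Metric.ball y r := Metric.closedBall_subset_ball (by linarith)
  have hφ0 : ∀ x ∉ K, φ x = 0 := by
    intro x hx
    by_cases hxr : x ∈ Metric.ball y r
    · have h1 := (hball x hxr).1.1
      have h2 : r / 2 < ‖x - y‖ := by
        rwa [hK, Metric.mem_closedBall, dist_eq_norm, not_le] at hx
      have h3 : (r / 2) ^ 2 ≤ ‖x - y‖ ^ 2 := by gcongr
      have h4 : w x ≤ 0 := by
        have := mul_le_mul_of_nonneg_left h3 hε.le
        simp only [hw]; linarith
      simp [hφ, Set.indicator_of_mem hxr, max_eq_right h4]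
    · simp [hφ, Set.indicator_of_notMem hxr]
  have hts : tsupport φ ⊆ K :=
    closure_minimal (fun x hx => by_contra fun hxK => hx (hφ0 x hxK)) Metric.isClosed_closedBall
  have hφeq : ∀ x ∈ Metric.ball y r, φ =ᶠ[𝓝 x] fun z => (max (w z) 0) ^ 2 := fun x hx => by
    filter_upwards [Metric.isOpen_ball.mem_nhds hx] with z hz
    simp [hφ, Set.indicator_of_mem hz]
  have hwC : ∀ x ∈ Metric.ball y r, ContDiffAt ℝ 1 w x := fun x hx =>
    ((hu.1.1.contDiffAt (hS.mem_nhds (hball x hx).2)).sub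
      (contDiff_quadPoly a b c d e y).contDiffAt).add contDiffAt_const
  have hφC : ContDiff ℝ 1 φ := by
    rw [contDiff_iff_contDiffAt]
    intro x
    by_cases hx : x ∈ Metric.ball y r
    · exact ((contDiff_max_zero_sq.contDiffAt).comp x (hwC x hx)).congr_of_eventuallyEq (hφeq x hx)
    · refine contDiffAt_const (c := (0 : ℝ)) |>.congr_of_eventuallyEq ?_
      filter_upwards [Metric.isClosed_closedBall.isOpen_compl.mem_nhds
        (fun hxK => hx (hKr hxK) : x ∈ Kᶜ)] with z hz using hφ0 z hz
  have hKS : K ⊆ Ω \ {0} := fun x hx => (hball x (hKr hx)).2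
  have hKc : IsCompact K := isCompact_closedBall y (r / 2)
  have hφcs : HasCompactSupport φ := HasCompactSupport.intro hKc hφ0
  have hφt : IsTestFun Ω φ := ⟨hφC, hφcs, hts.trans hKS⟩
  have hφnn : ∀ x, 0 ≤ φ x := fun x => Set.indicator_nonneg (fun z _ => sq_nonneg _) x
  have hgrad : ∀ x ∈ Metric.ball y r, gradient φ x
      = (2 * max (w x) 0) • (gradient u x - quadGrad b c d e y x) := by
    intro x hx
    have hgu := ((hu.1.1.contDiffAt (hS.mem_nhds (hball x hx).2)).differentiableAt
      one_ne_zero).hasGradientAt.hasFDerivAt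
    have hgw : HasFDerivAt w _ x :=
      (hgu.sub (hasGradientAt_quadPoly a b c d e y x).hasFDerivAt).add_const _
    refine HasGradientAt.gradient (hasGradientAt_iff_hasFDerivAt.2 ?_)
    have := ((hasDerivAt_max_zero_sq (w x)).comp_hasFDerivAt x hgw).congr_of_eventuallyEq
      (hφeq x hx)
    refine this.congr_fderiv ?_
    simp
  have hsub := hu.2 φ hφt hφnn
  rw [weakE_eq_integral ρ lam θ q hτ hΩ hu.1 hφt] at hsub
  have hibp := integral_inner_quadGrad_gradient volume hφC hφcs b c d e y
  rw [finrank_euclideanSpace_fin, ← hm, ← integral_const_mul] at hibp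
  set H : EuclideanSpace ℝ (Fin N) → ℝ := fun x =>
    ⟪gradient u x - quadGrad b c d e y x, gradient φ x⟫
      + (lowerTerms ρ lam τ θ q u x - m) * φ x with hH
  have hoff : ∀ x ∉ K, gradient φ x = 0 := fun x hx =>
    gradient_of_notMem_tsupport fun hx' => hx (hts hx')
  have hgφ : Continuous (gradient φ) :=
    continuousOn_univ.1 (hφC.contDiffOn.continuousOn_gradient isOpen_univ)
  have hgu := hu.1.1.continuousOn_gradient hS
  have hQ := continuous_quadGrad b c d e y
  obtain ⟨hA1, hA2⟩ := ContinuousOn.continuous_and_hasCompactSupport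
    (h := fun x => ⟪gradient u x, gradient φ x⟫ + lowerTerms ρ lam τ θ q u x * φ x) hS
    ((hgu.inner hgφ.continuousOn).add (hFc.mul hφC.continuous.continuousOn)) hKc hKS
    fun x hx => by simp [hoff x hx, hφ0 x hx]
  obtain ⟨hB1, hB2⟩ := ContinuousOn.continuous_and_hasCompactSupport
    (h := fun x => ⟪quadGrad b c d e y x, gradient φ x⟫) hS
    (hQ.continuousOn.inner hgφ.continuousOn) hKc hKS fun x hx => by simp [hoff x hx]
  obtain ⟨hC1, hC2⟩ := ContinuousOn.continuous_and_hasCompactSupport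
    (h := fun x => m * φ x) hS
    (continuousOn_const.mul hφC.continuous.continuousOn) hKc hKS fun x hx => by simp [hφ0 x hx]
  have iA := hA1.integrable_of_hasCompactSupport (μ := volume) hA2
  have iB := hB1.integrable_of_hasCompactSupport (μ := volume) hB2
  have iC := hC1.integrable_of_hasCompactSupport (μ := volume) hC2
  have hHeq : H = fun x => (⟪gradient u x, gradient φ x⟫ + lowerTerms ρ lam τ θ q u x * φ x)
      - ⟪quadGrad b c d e y x, gradient φ x⟫ - m * φ x := by
    funext x
    simp only [hH, inner_sub_left]
    ring
  have hHle : ∫ x, H x ≤ 0 := by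
    have iAB : Integrable fun x =>
        (⟪gradient u x, gradient φ x⟫ + lowerTerms ρ lam τ θ q u x * φ x)
          - ⟪quadGrad b c d e y x, gradient φ x⟫ := iA.sub iB
    rw [hHeq, integral_sub iAB iC, integral_sub iA iB, hibp]
    linarith
  have hHc : Continuous H := by rw [hHeq]; exact (hA1.sub hB1).sub hC1
  have hH0 : ∀ x ∉ K, H x = 0 := fun x hx => by
    simp only [hH, hoff x hx, hφ0 x hx, inner_zero_right, mul_zero, add_zero]
  have hHcs : HasCompactSupport H := HasCompactSupport.intro hKc hH0
  have hfirst : ∀ x ∈ Metric.ball y r,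
      0 ≤ ⟪gradient u x - quadGrad b c d e y x, gradient φ x⟫ := fun x hx => by
    rw [hgrad x hx, real_inner_smul_right]
    exact mul_nonneg (by positivity) real_inner_self_nonneg
  have hHnn : 0 ≤ H := by
    intro x
    by_cases hx : x ∈ Metric.ball y r
    · exact add_nonneg (hfirst x hx)
        (mul_nonneg (sub_nonneg.2 (hball x hx).1.2.le) (hφnn x))
    · exact (hH0 x fun h => hx (hKr h)).ge
  have hyr : y ∈ Metric.ball y r := Metric.mem_ball_self hr
  have hφy : 0 < φ y := by
    rw [hφ, Set.indicator_of_mem hyr, hwy]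
    positivity
  have hHy : H y ≠ 0 :=
    (add_pos_of_nonneg_of_pos (hfirst y hyr) (mul_pos (sub_pos.2 hlt) hφy)).ne'
  exact absurd hHle (not_le.2
    (hHc.integral_pos_of_hasCompactSupport_nonneg_nonzero hHcs hHnn hHy))

/-- A sub-solution touched from above at `y` by a quadratic polynomial, up to an arbitrarily small
quadratic error, satisfies the equation at `y` with the appropriate inequality. -/
lemma IsSubSolutionE.lowerTerms_le_of_touch {N : ℕ} {ρ lam τ θ q : ℝ} (hτ : τ < 1)
    {Ω : Set (EuclideanSpace ℝ (Fin N))} (hΩ : IsOpen Ω) {u : EuclideanSpace ℝ (Fin N) → ℝ}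
    (hu : IsSubSolutionE N ρ lam τ θ q Ω u) {a c d : ℝ} {b e y : EuclideanSpace ℝ (Fin N)}
    (hy : y ∈ Ω \ {0}) (ha : u y = a)
    (htouch : ∀ ε > 0, ∀ᶠ x in 𝓝 y, u x ≤ quadPoly a b (c + ε) d e y x) :
    lowerTerms ρ lam τ θ q u y ≤ 2 * c * N + 2 * d * ‖e‖ ^ 2 := by
  refine le_of_forall_pos_le_add fun δ hδ => ?_
  have hε : 0 < δ / (4 * (N + 1)) := by positivity
  set ε := δ / (4 * (N + 1)) with hεdef
  have h := hu.lowerTerms_le_of_strict hτ hΩ (c := c + ε + ε) (d := d) (b := b) (e := e) hε hy ha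
    (by
      filter_upwards [htouch ε hε] with x hx
      refine hx.trans (le_of_eq ?_)
      simp only [quadPoly]; ring)
  have : 4 * N * ε ≤ δ := by
    rw [hεdef, mul_div_assoc', div_le_iff₀ (by positivity)]
    nlinarith
  linarith

/-- At a point where a quadratic polynomial touches `u` from above the gradients agree. -/
lemma gradient_eq_of_touch {E : Type*} [NormedAddCommGroup E] [InnerProductSpace ℝ E]
    [CompleteSpace E] {u : E → ℝ} {a c d : ℝ} {b e y : E} (hu : DifferentiableAt ℝ u y)
    (ha : u y = a) (htouch : ∀ᶠ x in 𝓝 y, u x ≤ quadPoly a b c d e y x) :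
    gradient u y = b := by
  have hmax : IsLocalMax (fun x => u x - quadPoly a b c d e y x) y := by
    filter_upwards [htouch] with x hx
    have : quadPoly a b c d e y y = a := by simp [quadPoly]
    linarith
  have h0 := hmax.hasFDerivAt_eq_zero
    (hu.hasGradientAt.hasFDerivAt.sub (hasGradientAt_quadPoly a b c d e y y).hasFDerivAt)
  rw [← map_sub] at h0
  have h1 := (LinearIsometryEquiv.map_eq_zero_iff _).1 h0
  simpa [quadGrad, sub_eq_zero] using h1

/-- Second-order upper bound at `y` for `g (‖e + (x - y)‖ ^ 2 - ‖e‖ ^ 2)`, a radial function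
centred at `y - e`. -/
lemma eventually_radial_le_quadPoly {E : Type*} [NormedAddCommGroup E] [InnerProductSpace ℝ E]
    {g g' : ℝ → ℝ} {c ε : ℝ} (hε : 0 < ε) (hg : ∀ᶠ t in 𝓝 0, HasDerivAt g (g' t) t)
    (hg' : HasDerivAt g' c 0) (e y : E) :
    ∀ᶠ x in 𝓝 y, g (2 * ⟪e, x - y⟫ + ‖x - y‖ ^ 2)
      ≤ quadPoly (g 0) ((2 * g' 0) • e) (g' 0 + ε) (2 * c) e y x := by
  set L := 2 * ‖e‖ + 1 with hL
  have hL0 : 0 < L := by positivity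
  have hη : 0 < ε / (2 * L ^ 2) := by positivity
  set η := ε / (2 * L ^ 2) with hηdef
  have ht : Tendsto (fun x => 2 * ⟪e, x - y⟫ + ‖x - y‖ ^ 2) (𝓝 y) (𝓝 0) := by
    have : Continuous fun x => 2 * ⟪e, x - y⟫ + ‖x - y‖ ^ 2 := by fun_prop
    simpa using this.tendsto y
  have hs : ∀ᶠ x in 𝓝 y, c / 2 * (4 * ⟪e, x - y⟫ + ‖x - y‖ ^ 2) < ε / 2 := by
    have : Continuous fun x => c / 2 * (4 * ⟪e, x - y⟫ + ‖x - y‖ ^ 2) := by fun_prop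
    exact this.tendsto y |>.eventually (gt_mem_nhds (by simpa using hε))
  filter_upwards [ht.eventually (eventually_le_taylor_two hη hg hg'), hs,
    Metric.ball_mem_nhds y one_pos] with x hx1 hx2 hx3
  have hn1 : ‖x - y‖ ≤ 1 := by rw [← dist_eq_norm]; exact (Metric.mem_ball.1 hx3).le
  have hp : |⟪e, x - y⟫| ≤ ‖e‖ * ‖x - y‖ := abs_real_inner_le_norm e (x - y)
  refine hx1.trans ?_
  simp only [quadPoly, real_inner_smul_left]
  set p := ⟪e, x - y⟫
  set n := ‖x - y‖
  have hn0 : 0 ≤ n := norm_nonneg _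
  have habs : |2 * p + n ^ 2| ≤ L * n := by
    rw [abs_le] at hp ⊢
    constructor <;> nlinarith
  have hsq : (2 * p + n ^ 2) ^ 2 ≤ (L * n) ^ 2 := sq_le_sq' (abs_le.1 habs).1 (abs_le.1 habs).2
  have h1 : η * (2 * p + n ^ 2) ^ 2 ≤ ε / 2 * n ^ 2 := by
    calc η * (2 * p + n ^ 2) ^ 2 ≤ η * (L * n) ^ 2 := by gcongr
      _ = ε / 2 * n ^ 2 := by rw [hηdef]; field_simp
  have h2 : c / 2 * (4 * p + n ^ 2) * n ^ 2 ≤ ε / 2 * n ^ 2 := by gcongr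
  nlinarith

/-- Pointwise estimate at the maximum point `y` of `u (R² - |x - x₀|²)^α`. -/
lemma IsSubSolutionE.estimate_at_max {N : ℕ} {ρ lam τ θ q α R : ℝ} (hτ0 : 0 ≤ τ) (hτ : τ < 1)
    (hα : 0 < α) {Ω : Set (EuclideanSpace ℝ (Fin N))} (hΩ : IsOpen Ω)
    {u : EuclideanSpace ℝ (Fin N) → ℝ} (hu : IsSubSolutionE N ρ lam τ θ q Ω u)
    {x₀ y : EuclideanSpace ℝ (Fin N)} (hR : 0 < R) (hy : y ∈ Ω \ {0}) (hyR : R ≤ ‖y‖)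
    (hlt : ‖y - x₀‖ < R)
    (hmax : ∀ᶠ x in 𝓝 y, u x * (R ^ 2 - ‖x - x₀‖ ^ 2) ^ α
      ≤ u y * (R ^ 2 - ‖y - x₀‖ ^ 2) ^ α) :
    ‖y‖ ^ θ * u y ^ q * (R ^ 2 - ‖y - x₀‖ ^ 2) ^ 2
      ≤ u y * (R ^ 2 * (2 * α * (2 * (α + 1) + N + |(N : ℝ) - 2 + 2 * ρ| + (1 - τ) * max lam 0)
        + τ * max lam 0)) := by
  set e := y - x₀ with he
  set ψ := R ^ 2 - ‖e‖ ^ 2 with hψ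
  set U := u y with hUdef
  have hU : 0 < U := hu.1.2 y hy
  have hψ0 : 0 < ψ := by
    have : ‖e‖ ^ 2 < R ^ 2 := by gcongr
    linarith
  set g : ℝ → ℝ := fun t => U * (1 - t / ψ) ^ (-α) with hg
  set g' : ℝ → ℝ := fun t => U * (α / ψ * (1 - t / ψ) ^ (-α - 1)) with hg'
  have hlin : ∀ t, HasDerivAt (fun t : ℝ => 1 - t / ψ) (-(1 / ψ)) t := fun t =>
    ((hasDerivAt_id t).div_const ψ).const_sub 1
  have hpos : ∀ᶠ t in 𝓝 (0 : ℝ), 0 < 1 - t / ψ := by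
    have : Continuous fun t : ℝ => 1 - t / ψ := by fun_prop
    exact this.tendsto 0 |>.eventually (lt_mem_nhds (by simp))
  have hgd : ∀ᶠ t in 𝓝 0, HasDerivAt g (g' t) t := by
    filter_upwards [hpos] with t ht
    refine (((hlin t).rpow_const (p := -α) (.inl ht.ne')).const_mul U).congr_deriv ?_
    simp only [hg']
    ring
  have hg'd : HasDerivAt g' (U * (α * (α + 1) / ψ ^ 2)) 0 := by
    refine ((((hlin 0).rpow_const (p := -α - 1) (.inl (by simp))).const_mul (α / ψ)).const_mul
      U).congr_deriv ?_
    simp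
    field_simp
    ring
  have hg0 : g 0 = U := by simp [hg]
  have hg'0 : g' 0 = U * (α / ψ) := by simp [hg']
  have htouch : ∀ ε > 0, ∀ᶠ x in 𝓝 y, u x
      ≤ quadPoly U ((2 * (U * (α / ψ))) • e) (U * (α / ψ) + ε) (2 * (U * (α * (α + 1) / ψ ^ 2)))
        e y x := by
    intro ε hε
    have h := eventually_radial_le_quadPoly hε hgd hg'd e y
    rw [hg0, hg'0] at h
    have hψx : ∀ᶠ x in 𝓝 y, 0 < R ^ 2 - ‖x - x₀‖ ^ 2 := by
      have : Continuous fun x => R ^ 2 - ‖x - x₀‖ ^ 2 := by fun_prop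
      exact this.tendsto y |>.eventually (lt_mem_nhds hψ0)
    filter_upwards [h, hmax, hψx] with x hx1 hx2 hx3
    refine le_trans ?_ hx1
    have hexp : R ^ 2 - ‖x - x₀‖ ^ 2 = ψ - (2 * ⟪e, x - y⟫ + ‖x - y‖ ^ 2) := by
      have : x - x₀ = e + (x - y) := by rw [he]; abel
      rw [this, norm_add_sq_real, hψ]
      ring
    have hquot : 1 - (2 * ⟪e, x - y⟫ + ‖x - y‖ ^ 2) / ψ = (R ^ 2 - ‖x - x₀‖ ^ 2) / ψ := by
      rw [hexp, sub_div, div_self hψ0.ne']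
    simp only [hg]
    rw [hquot, rpow_neg (by positivity), div_rpow hx3.le hψ0.le, inv_div, mul_div_assoc',
      le_div_iff₀ (by positivity)]
    exact hx2
  have hgrad : gradient u y = (2 * (U * (α / ψ))) • e :=
    gradient_eq_of_touch ((hu.1.1.contDiffAt
      ((hΩ.sdiff isClosed_singleton).mem_nhds hy)).differentiableAt one_ne_zero) rfl
      (htouch 1 one_pos)
  have hmain := hu.lowerTerms_le_of_touch hτ hΩ hy rfl htouch
  have hY : 0 < ‖y‖ := hR.trans_le hyR
  set D := 2 * (U * (α / ψ)) with hD
  have hD0 : 0 < D := by positivity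
  have hgn : ‖gradient u y‖ ≤ D * ‖y‖ := by
    rw [hgrad, norm_smul, Real.norm_of_nonneg hD0.le]
    gcongr
    linarith
  have hdrift : |⟪y, gradient u y⟫ / ‖y‖ ^ 2| ≤ D := by
    rw [abs_div, abs_of_pos (by positivity : 0 < ‖y‖ ^ 2), div_le_iff₀ (by positivity)]
    calc |⟪y, gradient u y⟫| ≤ ‖y‖ * ‖gradient u y‖ := abs_real_inner_le_norm _ _
      _ ≤ ‖y‖ * (D * ‖y‖) := by gcongr
      _ = D * ‖y‖ ^ 2 := by ring
  have hdrift' : -(|(N : ℝ) - 2 + 2 * ρ| * D)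
      ≤ ((N : ℝ) - 2 + 2 * ρ) * (⟪y, gradient u y⟫ / ‖y‖ ^ 2) := by
    refine le_trans (neg_le_neg ?_) (neg_abs_le _)
    rw [abs_mul]
    gcongr
  have hG0 : 0 ≤ Gt τ y (u y) (gradient u y) := by
    rw [Gt]; positivity
  have hG : Gt τ y (u y) (gradient u y) ≤ τ * (U / R ^ 2) + (1 - τ) * D := by
    have hyoung := geom_mean_le_arith_mean2_weighted hτ0 (by linarith : 0 ≤ 1 - τ)
      (by positivity : 0 ≤ U / ‖y‖ ^ 2) (by positivity : 0 ≤ ‖gradient u y‖ / ‖y‖)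
      (by ring)
    have heq : Gt τ y (u y) (gradient u y)
        = (U / ‖y‖ ^ 2) ^ τ * (‖gradient u y‖ / ‖y‖) ^ (1 - τ) := by
      rw [Gt, div_rpow hU.le (by positivity), div_rpow (norm_nonneg _) hY.le, div_mul_div_comm,
        ← rpow_natCast, ← rpow_mul hY.le, ← rpow_add hY]
      congr 2
      push_cast
      ring
    rw [heq]
    refine hyoung.trans (add_le_add ?_ ?_)
    · gcongr
    · have : 0 ≤ 1 - τ := by linarith
      gcongr
      rwa [div_le_iff₀ hY]
  have hlamG : lam * Gt τ y (u y) (gradient u y)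
      ≤ max lam 0 * (τ * (U / R ^ 2) + (1 - τ) * D) :=
    mul_le_mul (le_max_left _ _) hG hG0 (le_max_right _ _)
  rw [lowerTerms, ← hUdef] at hmain
  rw [← hUdef] at hlamG
  have hsum : ‖y‖ ^ θ * U ^ q ≤ D * N + 4 * (U * (α * (α + 1) / ψ ^ 2)) * ‖e‖ ^ 2
      + |(N : ℝ) - 2 + 2 * ρ| * D + max lam 0 * (τ * (U / R ^ 2) + (1 - τ) * D) := by
    have : D * N = 2 * (U * (α / ψ)) * N := by rw [hD]
    linarith
  have hψR : ψ ≤ R ^ 2 := by rw [hψ]; linarith [sq_nonneg ‖e‖]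
  have hDψ : D * ψ ^ 2 = U * (2 * α * ψ) := by rw [hD]; field_simp
  have heR : ‖e‖ ^ 2 ≤ R ^ 2 := by linarith
  have hA : D * ψ ^ 2 ≤ U * (2 * α * R ^ 2) := by rw [hDψ]; gcongr
  have hB : 4 * (U * (α * (α + 1) / ψ ^ 2)) * ‖e‖ ^ 2 * ψ ^ 2
      ≤ U * (4 * α * (α + 1) * R ^ 2) := by
    calc 4 * (U * (α * (α + 1) / ψ ^ 2)) * ‖e‖ ^ 2 * ψ ^ 2
        = U * (4 * α * (α + 1) * ‖e‖ ^ 2) := by field_simp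
      _ ≤ _ := by gcongr
  have hC : U / R ^ 2 * ψ ^ 2 ≤ U * R ^ 2 := by
    rw [div_mul_eq_mul_div, div_le_iff₀ (by positivity)]
    calc U * ψ ^ 2 ≤ U * (R ^ 2) ^ 2 := by gcongr
      _ = _ := by ring
  have hl0 : 0 ≤ max lam 0 := le_max_right _ _
  have hcoef : 0 ≤ (N : ℝ) + |(N : ℝ) - 2 + 2 * ρ| + max lam 0 * (1 - τ) := by
    have : 0 ≤ 1 - τ := by linarith
    positivity
  calc ‖y‖ ^ θ * U ^ q * ψ ^ 2
      ≤ (D * N + 4 * (U * (α * (α + 1) / ψ ^ 2)) * ‖e‖ ^ 2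
      + |(N : ℝ) - 2 + 2 * ρ| * D + max lam 0 * (τ * (U / R ^ 2) + (1 - τ) * D)) * ψ ^ 2 := by
        gcongr
    _ = ((N : ℝ) + |(N : ℝ) - 2 + 2 * ρ| + max lam 0 * (1 - τ)) * (D * ψ ^ 2)
        + 4 * (U * (α * (α + 1) / ψ ^ 2)) * ‖e‖ ^ 2 * ψ ^ 2
        + max lam 0 * τ * (U / R ^ 2 * ψ ^ 2) := by ring
    _ ≤ ((N : ℝ) + |(N : ℝ) - 2 + 2 * ρ| + max lam 0 * (1 - τ)) * (U * (2 * α * R ^ 2))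
        + U * (4 * α * (α + 1) * R ^ 2) + max lam 0 * τ * (U * R ^ 2) := by
        gcongr
    _ = _ := by ring

/-- A priori bound. With
`C₀ = 2^{|θ|/(q-1)} [ (16/(q-1)) ( 2(q+1)/(q-1) + N + |N-2+2ρ| + (1-τ)λ⁺ ) + 4τλ⁺ ]^{1/(q-1)}`,
if the closed ball of radius `2r₀` about `0` lies in `Ω`, then every positive sub-solution
`u` of (E) in `Ω \ {0}` satisfies `u(x) ≤ C₀ |x|^{-β}` for `0 < |x| ≤ r₀`. -/
theorem stmt16_apriori_bound
    (N : ℕ) (hN : 2 ≤ N) (ρ lam τ θ q : ℝ)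
    (hτ0 : 0 ≤ τ) (hτ1 : τ < 1) (hq : 1 < q)
    (Ω : Set (EuclideanSpace ℝ (Fin N))) (hΩ : IsOpen Ω)
    (r0 : ℝ) (hr0 : 0 < r0)
    (hball : Metric.closedBall (0 : EuclideanSpace ℝ (Fin N)) (2 * r0) ⊆ Ω)
    (u : EuclideanSpace ℝ (Fin N) → ℝ)
    (hu : IsSubSolutionE N ρ lam τ θ q Ω u) :
    ∀ x : EuclideanSpace ℝ (Fin N), 0 < ‖x‖ → ‖x‖ ≤ r0 →
      u x ≤ ((2 : ℝ) ^ (|θ| / (q - 1)) *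
          ((16 / (q - 1)) * (2 * (q + 1) / (q - 1) + (N : ℝ) + |(N : ℝ) - 2 + 2 * ρ|
              + (1 - τ) * max lam 0) + 4 * τ * max lam 0) ^ (1 / (q - 1))) *
        ‖x‖ ^ (-((θ + 2) / (q - 1))) := by
  intro x₀ hx0 hxr
  set r := ‖x₀‖ with hr
  have hq1 : 0 < q - 1 := by linarith
  set α := 2 / (q - 1) with hαdef
  have hα : 0 < α := by positivity
  have hαq : α * (q - 1) = 2 := div_mul_cancel₀ _ hq1.ne'
  set R := r / 2 with hRdef
  have hR : 0 < R := by positivity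
  set K := 2 * α * (2 * (α + 1) + N + |(N : ℝ) - 2 + 2 * ρ| + (1 - τ) * max lam 0)
    + τ * max lam 0 with hK
  have hlower : ∀ x ∈ Metric.closedBall x₀ R, R ≤ ‖x‖ := fun x hx => by
    have h1 : ‖x - x₀‖ ≤ R := by rwa [← dist_eq_norm]
    have h2 := norm_sub_norm_le x₀ x
    rw [norm_sub_rev] at h2
    linarith
  have hupper : ∀ x ∈ Metric.closedBall x₀ R, ‖x‖ ≤ 3 * R := fun x hx => by
    have h1 : ‖x - x₀‖ ≤ R := by rwa [← dist_eq_norm]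
    have h2 := norm_sub_norm_le x x₀
    linarith
  have hsub : Metric.closedBall x₀ R ⊆ Ω \ {0} := fun x hx => by
    refine ⟨hball ?_, norm_pos_iff.1 (hR.trans_le (hlower x hx))⟩
    rw [mem_closedBall_zero_iff]
    linarith [hupper x hx]
  have hx₀mem : x₀ ∈ Metric.closedBall x₀ R := Metric.mem_closedBall_self hR.le
  have hcont : ContinuousOn (fun x => u x * (R ^ 2 - ‖x - x₀‖ ^ 2) ^ α)
      (Metric.closedBall x₀ R) :=
    (hu.1.1.continuousOn.mono hsub).mul
      (ContinuousOn.rpow_const (by fun_prop) fun _ _ => .inr hα.le)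
  obtain ⟨y, hyB, hymax⟩ := (isCompact_closedBall x₀ R).exists_isMaxOn ⟨x₀, hx₀mem⟩ hcont
  have hux₀ : 0 < u x₀ := hu.1.2 x₀ (hsub hx₀mem)
  have huy : 0 < u y := hu.1.2 y (hsub hyB)
  have hcmp : u x₀ * (R ^ 2) ^ α ≤ u y * (R ^ 2 - ‖y - x₀‖ ^ 2) ^ α := by
    simpa using hymax hx₀mem
  have hylt : ‖y - x₀‖ < R := by
    refine lt_of_le_of_ne (by rwa [← dist_eq_norm]) fun h => ?_
    rw [h, sub_self, zero_rpow hα.ne', mul_zero] at hcmp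
    exact absurd hcmp (not_le.2 (by positivity))
  have hest := hu.estimate_at_max hτ0 hτ1 hα hΩ hR (hsub hyB) (hlower y hyB) hylt (by
    filter_upwards [Metric.isOpen_ball.mem_nhds (by rwa [Metric.mem_ball, dist_eq_norm] :
      y ∈ Metric.ball x₀ R)] with x hx using hymax (Metric.ball_subset_closedBall hx))
  rw [← hK] at hest
  set ψ := R ^ 2 - ‖y - x₀‖ ^ 2 with hψ
  have hψ0 : 0 < ψ := by
    have : ‖y - x₀‖ ^ 2 < R ^ 2 := by gcongr
    linarith
  have hY : 0 < ‖y‖ := hR.trans_le (hlower y hyB)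
  have hest' : ‖y‖ ^ θ * (u y ^ (q - 1) * ψ ^ 2) ≤ R ^ 2 * K := by
    have hsplit : u y ^ q = u y * u y ^ (q - 1) := by
      rw [rpow_sub_one huy.ne', mul_div_cancel₀ _ huy.ne']
    rw [hsplit] at hest
    refine le_of_mul_le_mul_left ?_ huy
    linarith
  have hpow : ∀ s : ℝ, 0 < s → (s ^ α) ^ (q - 1) = s ^ 2 := fun s hs => by
    rw [← rpow_mul hs.le, hαq, rpow_two]
  have hcmp' : u x₀ ^ (q - 1) * (R ^ 2) ^ 2 ≤ u y ^ (q - 1) * ψ ^ 2 := by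
    have h := rpow_le_rpow (by positivity) hcmp hq1.le
    rwa [mul_rpow hux₀.le (by positivity), mul_rpow huy.le (by positivity),
      hpow _ (by positivity), hpow _ hψ0] at h
  have hratio : r ^ θ ≤ 2 ^ |θ| * ‖y‖ ^ θ := by
    have h1 : ‖y‖ / r ≤ 2 := by
      rw [div_le_iff₀ hx0]; linarith [hupper y hyB]
    have h2 : r / ‖y‖ ≤ 2 := by
      rw [div_le_iff₀ hY]; linarith [hlower y hyB]
    have h3 : (r / ‖y‖) ^ θ ≤ 2 ^ |θ| := by
      rcases le_total 0 θ with hθ | hθ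
      · rw [abs_of_nonneg hθ]
        exact rpow_le_rpow (by positivity) h2 hθ
      · rw [abs_of_nonpos hθ, ← inv_div, inv_rpow (by positivity), ← rpow_neg (by positivity)]
        exact rpow_le_rpow (by positivity) h1 (by linarith)
    rwa [div_rpow hx0.le hY.le, div_le_iff₀ (by positivity)] at h3
  have hfinal : u x₀ ^ (q - 1) ≤ 2 ^ |θ| * (4 * K) * r ^ (-(θ + 2)) := by
    have h1 : ‖y‖ ^ θ * (u x₀ ^ (q - 1) * (R ^ 2) ^ 2) ≤ R ^ 2 * K :=
      le_trans (by gcongr) hest'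
    have h2 : ‖y‖ ^ θ * (u x₀ ^ (q - 1) * R ^ 2) ≤ K := by
      refine le_of_mul_le_mul_left ?_ (by positivity : 0 < R ^ 2)
      linarith
    have h3 : u x₀ ^ (q - 1) * R ^ 2 * r ^ θ ≤ 2 ^ |θ| * K := by
      calc u x₀ ^ (q - 1) * R ^ 2 * r ^ θ
          ≤ u x₀ ^ (q - 1) * R ^ 2 * (2 ^ |θ| * ‖y‖ ^ θ) := by gcongr
        _ = 2 ^ |θ| * (‖y‖ ^ θ * (u x₀ ^ (q - 1) * R ^ 2)) := by ring
        _ ≤ _ := by gcongr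
    rw [rpow_neg hx0.le, ← div_eq_mul_inv, le_div_iff₀ (by positivity), rpow_add hx0, rpow_two]
    have : R ^ 2 = r ^ 2 / 4 := by rw [hRdef]; ring
    rw [this] at h3
    linarith
  have hK0 : 0 ≤ K := by
    have : 0 ≤ 1 - τ := by linarith
    positivity
  have hKeq : (16 / (q - 1)) * (2 * (q + 1) / (q - 1) + (N : ℝ) + |(N : ℝ) - 2 + 2 * ρ|
      + (1 - τ) * max lam 0) + 4 * τ * max lam 0 = 4 * K := by
    have : 2 * (q + 1) / (q - 1) = 2 * (α + 1) := by
      rw [hαdef]; field_simp; ring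
    rw [this, hK, hαdef]
    ring
  rw [hKeq]
  have hroot := rpow_le_rpow (by positivity) hfinal (by positivity : 0 ≤ 1 / (q - 1))
  rw [← rpow_mul hux₀.le, mul_one_div_cancel hq1.ne', rpow_one,
    mul_rpow (by positivity) (by positivity), mul_rpow (by positivity) (by positivity),
    ← rpow_mul (by norm_num), ← rpow_mul hx0.le] at hroot
  convert hroot using 3
  · ring_nf
  · ring

end
end

section
/- Assume β ∈ (ϖ2, 0) in Case [N2]. Then there is no positive solution u of equation (E) in ℝ^N∖{0} satisfying u(x)/Φ_{ϖ2}(|x|) → 0 as |x| → 0. -/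
open MeasureTheory Filter Topology Real RealInnerProductSpace

noncomputable section

/-- The divergence of a vector field on Euclidean space. -/
def divergence {N : ℕ} (X : EuclideanSpace ℝ (Fin N) → EuclideanSpace ℝ (Fin N))
    (x : EuclideanSpace ℝ (Fin N)) : ℝ :=
  ∑ i : Fin N, fderiv ℝ X x (EuclideanSpace.single i 1) i

lemma integrable_mul_of_tsupport {N : ℕ} {f φ : EuclideanSpace ℝ (Fin N) → ℝ}
    (hφ : Continuous φ) (hc : HasCompactSupport φ)
    (hf : ∀ x ∈ tsupport φ, ContinuousAt f x) :
    Integrable (fun x => f x * φ x) := by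
  refine Continuous.integrable_of_hasCompactSupport ?_ hc.mul_left
  refine continuous_of_tsupport fun x hx => ?_
  exact (hf x (tsupport_mul_subset_right hx)).mul hφ.continuousAt

lemma real_inner_gradient_right {N : ℕ} (v x : EuclideanSpace ℝ (Fin N))
    (φ : EuclideanSpace ℝ (Fin N) → ℝ) : ⟪v, gradient φ x⟫ = fderiv ℝ φ x v := by
  rw [real_inner_comm, ← toDual_gradient]
  simp

lemma map_eq_sum_single {N : ℕ} (T : EuclideanSpace ℝ (Fin N) →L[ℝ] ℝ)
    (v : EuclideanSpace ℝ (Fin N)) :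
    T v = ∑ i, v i * T (EuclideanSpace.single i 1) := by
  conv_lhs => rw [← (EuclideanSpace.basisFun (Fin N) ℝ).sum_repr v]
  simp

/-- Integration by parts for the divergence of a vector field which is `C¹` on the support of
the test function. -/
lemma integral_inner_gradient_eq_neg_divergence {N : ℕ}
    {X : EuclideanSpace ℝ (Fin N) → EuclideanSpace ℝ (Fin N)}
    {φ : EuclideanSpace ℝ (Fin N) → ℝ} (hφ : ContDiff ℝ 1 φ) (hc : HasCompactSupport φ)
    (hX : ∀ x ∈ tsupport φ, ContDiffAt ℝ 1 X x) :
    Integrable (fun x => ⟪X x, gradient φ x⟫) ∧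
    Integrable (fun x => divergence X x * φ x) ∧
    ∫ x, ⟪X x, gradient φ x⟫ = -∫ x, divergence X x * φ x := by
  have hcoord : ∀ i x, x ∈ tsupport φ → HasFDerivAt (fun y => X y i)
      ((EuclideanSpace.proj i : EuclideanSpace ℝ (Fin N) →L[ℝ] ℝ).comp (fderiv ℝ X x)) x :=
    fun i x hx => (EuclideanSpace.proj i : EuclideanSpace ℝ (Fin N) →L[ℝ] ℝ).hasFDerivAt.comp x
      ((hX x hx).differentiableAt (by norm_num)).hasFDerivAt
  have hfd : ∀ i x, x ∈ tsupport φ → fderiv ℝ (fun y => X y i) x (EuclideanSpace.single i 1)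
      = fderiv ℝ X x (EuclideanSpace.single i 1) i := fun i x hx => by
    rw [(hcoord i x hx).fderiv]; rfl
  have hDc : ∀ i x, x ∈ tsupport φ →
      ContinuousAt (fun y => fderiv ℝ X y (EuclideanSpace.single i 1) i) x := fun i x hx => by
    have h1 : ContinuousAt (fderiv ℝ X) x :=
      ((hX x hx).fderiv_right (m := 0) (by norm_num)).continuousAt
    have h2 : ContinuousAt (fun y => fderiv ℝ X y (EuclideanSpace.single i 1)) x :=
      h1.clm_apply continuousAt_const
    exact (EuclideanSpace.proj i : EuclideanSpace ℝ (Fin N) →L[ℝ] ℝ).continuous.continuousAt.comp h2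
  have hI1 : ∀ i, Integrable (fun x => fderiv ℝ X x (EuclideanSpace.single i 1) i * φ x) :=
    fun i => integrable_mul_of_tsupport hφ.continuous hc (hDc i)
  have hcongr : ∀ i, (fun x => fderiv ℝ X x (EuclideanSpace.single i 1) i * φ x) =
      fun x => fderiv ℝ (fun y => X y i) x (EuclideanSpace.single i 1) * φ x := fun i => by
    funext x
    by_cases hx : x ∈ tsupport φ
    · rw [hfd i x hx]
    · simp [image_eq_zero_of_notMem_tsupport hx]
  have hI2 : ∀ i, Integrable (fun x => X x i * fderiv ℝ φ x (EuclideanSpace.single i 1)) :=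
    fun i => by
    refine integrable_mul_of_tsupport
      ((hφ.continuous_fderiv (by norm_num)).clm_apply continuous_const)
      (hc.fderiv_apply ℝ _) fun x hx => ?_
    exact (hcoord i x (tsupport_fderiv_apply_subset ℝ _ hx)).continuousAt
  have hI3 : ∀ i, Integrable (fun x => X x i * φ x) := fun i =>
    integrable_mul_of_tsupport hφ.continuous hc fun x hx => (hcoord i x hx).continuousAt
  have hparts : ∀ i, ∫ x, X x i * fderiv ℝ φ x (EuclideanSpace.single i 1)
      = -∫ x, fderiv ℝ X x (EuclideanSpace.single i 1) i * φ x := fun i => by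
    rw [hcongr i]
    refine integral_mul_fderiv_eq_neg_fderiv_mul_of_integrable ?_ (hI2 i) (hI3 i)
      (fun x hx => (hcoord i x hx).differentiableAt)
      (fun x _ => hφ.differentiable (by norm_num) x)
    rw [← hcongr i]; exact hI1 i
  have e1 : (fun x => ⟪X x, gradient φ x⟫) =
      fun x => ∑ i, X x i * fderiv ℝ φ x (EuclideanSpace.single i 1) := by
    funext x; rw [real_inner_gradient_right, map_eq_sum_single]
  have e2 : (fun x => divergence X x * φ x) =
      fun x => ∑ i, fderiv ℝ X x (EuclideanSpace.single i 1) i * φ x := by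
    funext x; rw [divergence, Finset.sum_mul]
  rw [e1, e2]
  refine ⟨integrable_finsetSum _ fun i _ => hI2 i, integrable_finsetSum _ fun i _ => hI1 i, ?_⟩
  rw [integral_finsetSum _ fun i _ => hI2 i, integral_finsetSum _ fun i _ => hI1 i,
    ← Finset.sum_neg_distrib]
  exact Finset.sum_congr rfl fun i _ => hparts i

lemma integrable_of_continuousAt_of_eq_zero {N : ℕ} {F : EuclideanSpace ℝ (Fin N) → ℝ}
    {K : Set (EuclideanSpace ℝ (Fin N))} (hK : IsCompact K)
    (hF : ∀ x ∈ K, ContinuousAt F x) (h0 : ∀ x ∉ K, F x = 0) : Integrable F := by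
  refine Continuous.integrable_of_hasCompactSupport ?_ (HasCompactSupport.intro hK h0)
  refine continuous_iff_continuousAt.2 fun x => ?_
  by_cases hx : x ∈ K
  · exact hF x hx
  · have : F =ᶠ[𝓝 x] fun _ => 0 := by
      filter_upwards [hK.isClosed.isOpen_compl.mem_nhds hx] with y hy using h0 y hy
    exact continuousAt_const.congr this.symm

lemma hasDerivAt_sq_posPart (t : ℝ) :
    HasDerivAt (fun t : ℝ => (max t 0) ^ 2) (2 * max t 0) t := by
  rcases lt_trichotomy t 0 with ht | rfl | ht
  · have : (fun t : ℝ => (max t 0) ^ 2) =ᶠ[𝓝 t] fun _ => 0 := by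
      filter_upwards [Iio_mem_nhds ht] with y hy
      simp [max_eq_right (le_of_lt (Set.mem_Iio.1 hy))]
    rw [max_eq_right ht.le, mul_zero]
    exact (hasDerivAt_const t (0 : ℝ)).congr_of_eventuallyEq this
  · rw [max_self, mul_zero, hasDerivAt_iff_isLittleO_nhds_zero]
    have : (fun h : ℝ => (max (0 + h) 0) ^ 2 - (max (0 : ℝ) 0) ^ 2 - h • (0 : ℝ)) =O[𝓝 0]
        fun h : ℝ => h ^ 2 := by
      refine Asymptotics.IsBigO.of_bound 1 (Eventually.of_forall fun h => ?_)
      rcases le_total h 0 with hh | hh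
      · simp [max_eq_right hh, sq_nonneg]
      · simp [max_eq_left hh]
    exact this.trans_isLittleO (Asymptotics.isLittleO_pow_id one_lt_two)
  · have : (fun t : ℝ => (max t 0) ^ 2) =ᶠ[𝓝 t] fun t => t ^ 2 := by
      filter_upwards [Ioi_mem_nhds ht] with y hy
      simp [max_eq_left (le_of_lt (Set.mem_Ioi.1 hy))]
    rw [max_eq_left ht.le]
    simpa using (hasDerivAt_pow 2 t).congr_of_eventuallyEq this

lemma contDiff_sq_posPart : ContDiff ℝ 1 (fun t : ℝ => (max t 0) ^ 2) := by
  rw [contDiff_one_iff_deriv]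
  refine ⟨fun t => (hasDerivAt_sq_posPart t).differentiableAt, ?_⟩
  rw [show deriv (fun t : ℝ => (max t 0) ^ 2) = fun t => 2 * max t 0 from
    funext fun t => (hasDerivAt_sq_posPart t).deriv]
  fun_prop

lemma divergence_add_smul_sub {N : ℕ}
    {X : EuclideanSpace ℝ (Fin N) → EuclideanSpace ℝ (Fin N)}
    {x : EuclideanSpace ℝ (Fin N)} (hX : DifferentiableAt ℝ X x) (c : ℝ)
    (x₀ : EuclideanSpace ℝ (Fin N)) :
    divergence (fun y => X y + c • (y - x₀)) x = divergence X x + N * c := by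
  have h : HasFDerivAt (fun y => X y + c • (y - x₀))
      (fderiv ℝ X x + c • ContinuousLinearMap.id ℝ (EuclideanSpace ℝ (Fin N))) x :=
    hX.hasFDerivAt.add (((hasFDerivAt_id x).sub_const x₀).const_smul c)
  simp [divergence, h.fderiv, Finset.sum_add_distrib]

lemma continuousAt_divergence {N : ℕ}
    {X : EuclideanSpace ℝ (Fin N) → EuclideanSpace ℝ (Fin N)}
    {x : EuclideanSpace ℝ (Fin N)} (hX : ContDiffAt ℝ 1 X x) :
    ContinuousAt (divergence X) x := by
  have h1 : ContinuousAt (fderiv ℝ X) x :=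
    (hX.fderiv_right (m := 0) (by norm_num)).continuousAt
  refine tendsto_finsetSum _ fun i _ => ?_
  have h2 : ContinuousAt (fun y => fderiv ℝ X y (EuclideanSpace.single i 1)) x :=
    h1.clm_apply continuousAt_const
  exact (EuclideanSpace.proj i : EuclideanSpace ℝ (Fin N) →L[ℝ] ℝ).continuous.continuousAt.comp h2

lemma ContDiffAt.continuousAt_gradient {N : ℕ} {u : EuclideanSpace ℝ (Fin N) → ℝ}
    {x : EuclideanSpace ℝ (Fin N)} (hu : ContDiffAt ℝ 1 u x) :
    ContinuousAt (gradient u) x :=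
  (InnerProductSpace.toDual ℝ (EuclideanSpace ℝ (Fin N))).symm.continuous.continuousAt.comp
    (hu.fderiv_right (m := 0) (by norm_num)).continuousAt

lemma gradient_of_notMem_tsupport_s17 {N : ℕ} {φ : EuclideanSpace ℝ (Fin N) → ℝ}
    {x : EuclideanSpace ℝ (Fin N)} (hx : x ∉ tsupport φ) : gradient φ x = 0 := by
  simp [gradient, fderiv_of_notMem_tsupport (𝕜 := ℝ) hx]

/-- A `C¹` weak solution of `-Δu = g` satisfies `-ΔQ ≤ g` in the viscosity sense at points where
a function `Q` with `C¹` gradient `X` touches it from above. -/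
lemma neg_divergence_le_of_touches_above {N : ℕ} {u Q g : EuclideanSpace ℝ (Fin N) → ℝ}
    {X : EuclideanSpace ℝ (Fin N) → EuclideanSpace ℝ (Fin N)}
    {x₀ : EuclideanSpace ℝ (Fin N)} {r : ℝ} (hr : 0 < r)
    (hu : ∀ x ∈ Metric.ball x₀ r, ContDiffAt ℝ 1 u x)
    (hg : ∀ x ∈ Metric.ball x₀ r, ContinuousAt g x)
    (hweak : ∀ φ : EuclideanSpace ℝ (Fin N) → ℝ, ContDiff ℝ 1 φ → HasCompactSupport φ →
      tsupport φ ⊆ Metric.ball x₀ r →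
        ∫ x, ⟪gradient u x, gradient φ x⟫ = ∫ x, g x * φ x)
    (hX : ∀ x ∈ Metric.ball x₀ r, ContDiffAt ℝ 1 X x)
    (hQ : ∀ x ∈ Metric.ball x₀ r, ContDiffAt ℝ 1 Q x)
    (hQX : ∀ x ∈ Metric.ball x₀ r, HasGradientAt Q (X x) x)
    (hle : ∀ x ∈ Metric.ball x₀ r, u x ≤ Q x) (heq : u x₀ = Q x₀) :
    -divergence X x₀ ≤ g x₀ := by
  by_contra! hlt
  set κ : ℝ := -(g x₀ + divergence X x₀) / (2 * N + 1) with hκ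
  have hN1 : (0 : ℝ) < 2 * N + 1 := by positivity
  have hκ0 : 0 < κ := div_pos (by linarith) hN1
  have hκ1 : κ * (2 * N + 1) = -(g x₀ + divergence X x₀) := div_mul_cancel₀ _ hN1.ne'
  have hx₀ : x₀ ∈ Metric.ball x₀ r := Metric.mem_ball_self hr
  have hdc : ContinuousAt (fun x => g x + (divergence X x + N * (2 * κ))) x₀ :=
    (hg x₀ hx₀).add ((continuousAt_divergence (hX x₀ hx₀)).add continuousAt_const)
  have hd0 : g x₀ + (divergence X x₀ + N * (2 * κ)) < 0 := by nlinarith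
  obtain ⟨s, hs, hsd⟩ := Metric.eventually_nhds_iff_ball.1 (hdc.eventually (Iio_mem_nhds hd0))
  obtain ⟨R, hR0, hRr, hRs⟩ : ∃ R, 0 < R ∧ R ≤ r ∧ R ≤ s :=
    ⟨min r s, lt_min hr hs, min_le_left _ _, min_le_right _ _⟩
  have hball : Metric.ball x₀ R ⊆ Metric.ball x₀ r := Metric.ball_subset_ball hRr
  set Y : EuclideanSpace ℝ (Fin N) → EuclideanSpace ℝ (Fin N) := fun x => X x + (2 * κ) • (x - x₀) with hY
  set z : EuclideanSpace ℝ (Fin N) → ℝ := fun x => Q x - u x + κ * ‖x - x₀‖ ^ 2 with hz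
  set δ : ℝ := κ * R ^ 2 / 4 with hδ
  have hδ0 : 0 < δ := by positivity
  set φ : EuclideanSpace ℝ (Fin N) → ℝ := (Metric.ball x₀ R).indicator fun x => (max (δ - z x) 0) ^ 2 with hφ
  have hzd : ∀ x ∈ Metric.ball x₀ r, HasFDerivAt z
      (InnerProductSpace.toDual ℝ (EuclideanSpace ℝ (Fin N)) (Y x - gradient u x)) x := fun x hx => by
    have h1 := (hQX x hx).hasFDerivAt
    have h2 := ((hu x hx).differentiableAt (by norm_num)).hasGradientAt.hasFDerivAt
    have h3 := (((hasFDerivAt_id x).sub_const x₀).norm_sq).const_mul κ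
    refine ((h1.sub h2).add h3).congr_fderiv ?_
    ext v
    simp [hY]
    ring
  have hzC : ∀ x ∈ Metric.ball x₀ r, ContDiffAt ℝ 1 z x := fun x hx =>
    ((hQ x hx).sub (hu x hx)).add
      (contDiffAt_const.mul ((contDiffAt_id.sub contDiffAt_const).norm_sq ℝ))
  have hφev : ∀ x ∈ Metric.ball x₀ R, φ =ᶠ[𝓝 x] fun x => (max (δ - z x) 0) ^ 2 := fun x hx => by
    filter_upwards [Metric.isOpen_ball.mem_nhds hx] with y hy
    rw [hφ, Set.indicator_of_mem hy]
  have hφnn : ∀ x, 0 ≤ φ x := fun x => Set.indicator_nonneg (fun y _ => sq_nonneg _) x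
  have hφ0 : ∀ x ∉ Metric.closedBall x₀ (R / 2), φ x = 0 := fun x hx => by
    by_cases hxR : x ∈ Metric.ball x₀ R
    · rw [hφ, Set.indicator_of_mem hxR]
      have h1 : R / 2 < ‖x - x₀‖ := by simpa [dist_eq_norm] using hx
      have h2 := hle x (hball hxR)
      have h3 : δ ≤ z x := by
        have : κ * (R / 2) ^ 2 ≤ κ * ‖x - x₀‖ ^ 2 := by gcongr
        simp only [hδ, hz]; nlinarith
      simp [max_eq_right (sub_nonpos.2 h3)]
    · rw [hφ, Set.indicator_of_notMem hxR]
  have hts : tsupport φ ⊆ Metric.closedBall x₀ (R / 2) :=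
    closure_minimal (fun x hx => by_contra fun h => hx (hφ0 x h)) Metric.isClosed_closedBall
  have hcb : Metric.closedBall x₀ (R / 2) ⊆ Metric.ball x₀ R :=
    Metric.closedBall_subset_ball (by linarith)
  have hφc : HasCompactSupport φ := HasCompactSupport.intro (isCompact_closedBall _ _) hφ0
  have hφC : ContDiff ℝ 1 φ := contDiff_iff_contDiffAt.2 fun x => by
    by_cases hx : x ∈ Metric.ball x₀ R
    · exact (contDiff_sq_posPart.contDiffAt.comp x
        (contDiffAt_const.sub (hzC x (hball hx)))).congr_of_eventuallyEq (hφev x hx)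
    · have : φ =ᶠ[𝓝 x] fun _ => 0 := by
        filter_upwards [Metric.isClosed_closedBall.isOpen_compl.mem_nhds
          (fun h => hx (hcb h))] with y hy using hφ0 y hy
      exact contDiffAt_const.congr_of_eventuallyEq this
  have hsign : ∀ x, ⟪Y x, gradient φ x⟫ - ⟪gradient u x, gradient φ x⟫ ≤ 0 := fun x => by
    rw [← inner_sub_left]
    by_cases hx : x ∈ tsupport φ
    · have hxR := hcb (hts hx)
      have hd' := (hasDerivAt_sq_posPart (δ - z x)).comp_hasFDerivAt x
        ((hzd x (hball hxR)).const_sub δ)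
      have hd := hd'.congr_of_eventuallyEq (hφev x hxR)
      rw [real_inner_gradient_right, hd.fderiv]
      simp only [smul_eq_mul, smul_apply, neg_apply,
        InnerProductSpace.toDual_apply_apply, real_inner_self_eq_norm_sq]
      have := mul_nonneg (le_max_right (δ - z x) 0) (sq_nonneg ‖Y x - gradient u x‖)
      nlinarith
    · simp [gradient_of_notMem_tsupport_s17 hx]
  have hYC : ∀ x ∈ tsupport φ, ContDiffAt ℝ 1 Y x := fun x hx =>
    (hX x (hball (hcb (hts hx)))).add (contDiffAt_id.sub contDiffAt_const |>.const_smul (2 * κ))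
  obtain ⟨hI1, hI2, hparts⟩ := integral_inner_gradient_eq_neg_divergence hφC hφc hYC
  have hI3 : Integrable (fun x => ⟪gradient u x, gradient φ x⟫) := by
    refine integrable_of_continuousAt_of_eq_zero hφc (fun x hx => ?_)
      (fun x hx => by simp [gradient_of_notMem_tsupport_s17 hx])
    exact ((hu x (hball (hcb (hts hx)))).continuousAt_gradient).inner
      hφC.contDiffAt.continuousAt_gradient
  have hI4 : Integrable (fun x => g x * φ x) :=
    integrable_mul_of_tsupport hφC.continuous hφc fun x hx => hg x (hball (hcb (hts hx)))
  have hw := hweak φ hφC hφc (hts.trans (hcb.trans hball))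
  have hle0 : ∫ x, (⟪Y x, gradient φ x⟫ - ⟪gradient u x, gradient φ x⟫) ≤ 0 :=
    integral_nonpos hsign
  rw [integral_sub hI1 hI3, hparts, hw] at hle0
  have hposI : 0 < ∫ x, -(divergence Y x * φ x + g x * φ x) := by
    have hnn : ∀ x, 0 ≤ -(divergence Y x * φ x + g x * φ x) := fun x => by
      by_cases hx : x ∈ tsupport φ
      · have hxR := hcb (hts hx)
        have h1 : g x + (divergence X x + N * (2 * κ)) < 0 :=
          hsd x (Metric.ball_subset_ball hRs hxR)
        rw [hY, divergence_add_smul_sub ((hX x (hball hxR)).differentiableAt (by norm_num))]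
        have h2 := hφnn x
        nlinarith
      · simp [image_eq_zero_of_notMem_tsupport hx]
    have hcont : Continuous fun x => -(divergence Y x * φ x + g x * φ x) := by
      refine continuous_iff_continuousAt.2 fun x => ?_
      by_cases hx : x ∈ tsupport φ
      · exact ((((continuousAt_divergence (hYC x hx)).mul hφC.continuous.continuousAt)).add
          ((hg x (hball (hcb (hts hx)))).mul hφC.continuous.continuousAt)).neg
      · have : (fun x => -(divergence Y x * φ x + g x * φ x)) =ᶠ[𝓝 x] fun _ => 0 := by
          filter_upwards [(isClosed_tsupport φ).isOpen_compl.mem_nhds hx] with y hy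
          simp [image_eq_zero_of_notMem_tsupport hy]
        exact continuousAt_const.congr this.symm
    refine hcont.integral_pos_of_hasCompactSupport_nonneg_nonzero
      (x := x₀) (HasCompactSupport.intro hφc fun x hx => ?_) hnn ?_
    · simp [image_eq_zero_of_notMem_tsupport hx]
    · rw [hY, divergence_add_smul_sub ((hX x₀ hx₀).differentiableAt (by norm_num))]
      have h1 : φ x₀ = δ ^ 2 := by
        rw [hφ, Set.indicator_of_mem (Metric.mem_ball_self hR0)]
        simp [hz, heq, hδ0.le]
      rw [h1, ← add_mul]
      refine neg_ne_zero.2 (mul_ne_zero (by linarith) (by positivity))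
  rw [integral_neg, integral_add hI2 hI4] at hposI
  linarith

lemma hasFDerivAt_log_norm {N : ℕ} {x : EuclideanSpace ℝ (Fin N)} (hx : x ≠ 0) :
    HasFDerivAt (fun y : EuclideanSpace ℝ (Fin N) => Real.log ‖y‖)
      ((‖x‖ ^ 2)⁻¹ • innerSL ℝ x) x := by
  have hn : ‖x‖ ^ 2 ≠ 0 := by simpa using hx
  have h := ((hasStrictFDerivAt_norm_sq x).hasFDerivAt.log hn).const_mul (1 / 2 : ℝ)
  refine (h.congr_fderiv ?_).congr_of_eventuallyEq (Eventually.of_forall fun y => ?_)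
  · ext v; simp; ring
  · simp [Real.log_pow]

lemma contDiffAt_log_norm {N : ℕ} {x : EuclideanSpace ℝ (Fin N)} (hx : x ≠ 0) {n : WithTop ℕ∞} :
    ContDiffAt ℝ n (fun y : EuclideanSpace ℝ (Fin N) => Real.log ‖y‖) x :=
  (contDiffAt_norm ℝ hx).log (norm_ne_zero_iff.2 hx)

/-- The divergence of the radial field `c(log |x|) x / |x|²`. -/
lemma divergence_radial {N : ℕ} {x : EuclideanSpace ℝ (Fin N)} (hx : x ≠ 0) {c : ℝ → ℝ} {c' : ℝ}
    (hc : HasDerivAt c c' (Real.log ‖x‖)) :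
    divergence (fun y : EuclideanSpace ℝ (Fin N) => (c (Real.log ‖y‖) * (‖y‖ ^ 2)⁻¹) • y) x
      = (c' + (N - 2) * c (Real.log ‖x‖)) * (‖x‖ ^ 2)⁻¹ := by
  have hn : ‖x‖ ^ 2 ≠ 0 := by simpa using hx
  have h1 := hc.comp_hasFDerivAt x (hasFDerivAt_log_norm hx)
  have h2 := (hasDerivAt_inv hn).comp_hasFDerivAt x (hasStrictFDerivAt_norm_sq x).hasFDerivAt
  have h3 := (h1.mul h2).smul (hasFDerivAt_id x)
  have h4 : HasFDerivAt
      (fun y : EuclideanSpace ℝ (Fin N) => (c (Real.log ‖y‖) * (‖y‖ ^ 2)⁻¹) • y) _ x := h3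
  have hterm : ∀ i, fderiv ℝ
      (fun y : EuclideanSpace ℝ (Fin N) => (c (Real.log ‖y‖) * (‖y‖ ^ 2)⁻¹) • y) x
        (EuclideanSpace.single i 1) i = c (Real.log ‖x‖) * (‖x‖ ^ 2)⁻¹ +
          (c' - 2 * c (Real.log ‖x‖)) * ((‖x‖ ^ 2)⁻¹) ^ 2 * x i ^ 2 := fun i => by
    rw [h4.fderiv]
    simp [EuclideanSpace.inner_single_right]
    ring
  rw [divergence, Finset.sum_congr rfl fun i _ => hterm i, Finset.sum_add_distrib,
    ← Finset.mul_sum Finset.univ (fun i => x i ^ 2), ← EuclideanSpace.real_norm_sq_eq]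
  simp only [Finset.sum_const, Finset.card_univ, Fintype.card_fin, nsmul_eq_mul]
  field_simp
  ring

/-- A positive solution of (E) is a viscosity sub-solution with respect to radial functions of
`log |x|` touching it from above. -/
lemma IsSolutionE.radial_touches_above {N : ℕ} {ρ lam τ θ q : ℝ}
    {u : EuclideanSpace ℝ (Fin N) → ℝ} (hτ1 : τ < 1)
    (hu : IsSolutionE N ρ lam τ θ q Set.univ u) {x₀ : EuclideanSpace ℝ (Fin N)} (hx₀ : x₀ ≠ 0)
    {H : ℝ → ℝ} (hH : ContDiffAt ℝ 2 H (Real.log ‖x₀‖))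
    (hle : ∀ᶠ x in 𝓝 x₀, u x ≤ H (Real.log ‖x‖)) (heq : u x₀ = H (Real.log ‖x₀‖)) :
    ‖x₀‖ ^ (θ + 2) * u x₀ ^ q ≤ deriv (deriv H) (Real.log ‖x₀‖)
      - 2 * ρ * deriv H (Real.log ‖x₀‖)
      + lam * (u x₀ ^ τ * |deriv H (Real.log ‖x₀‖)| ^ (1 - τ)) := by
  obtain ⟨⟨huC, hupos⟩, hweak⟩ := hu
  have hopen : IsOpen (Set.univ \ {(0 : EuclideanSpace ℝ (Fin N))}) :=
    isOpen_univ.sdiff isClosed_singleton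
  have huC' : ∀ x, x ≠ 0 → ContDiffAt ℝ 1 u x := fun x hx =>
    huC.contDiffAt (hopen.mem_nhds ⟨Set.mem_univ _, hx⟩)
  have hup : ∀ x, x ≠ 0 → 0 < u x := fun x hx => hupos x ⟨Set.mem_univ _, hx⟩
  set Q : EuclideanSpace ℝ (Fin N) → ℝ := fun x => H (Real.log ‖x‖) with hQ
  set X : EuclideanSpace ℝ (Fin N) → EuclideanSpace ℝ (Fin N) :=
    fun y => (deriv H (Real.log ‖y‖) * (‖y‖ ^ 2)⁻¹) • y with hX
  set b : ℝ := (N : ℝ) - 2 + 2 * ρ with hb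
  set g : EuclideanSpace ℝ (Fin N) → ℝ := fun x =>
    -(b * (⟪x, gradient u x⟫ / ‖x‖ ^ 2)) + lam * Gt τ x (u x) (gradient u x)
      - ‖x‖ ^ θ * u x ^ q with hg
  have hDc : ∀ x, x ≠ 0 → ContinuousAt (fun x => ⟪x, gradient u x⟫ / ‖x‖ ^ 2) x := fun x hx =>
    (continuousAt_id.inner (huC' x hx).continuousAt_gradient).div
      (continuousAt_id.norm.pow 2) (by simpa using hx)
  have hGc : ∀ x, x ≠ 0 → ContinuousAt (fun x => Gt τ x (u x) (gradient u x)) x := fun x hx => by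
    have hnx : 0 < ‖x‖ := norm_pos_iff.2 hx
    refine ContinuousAt.div (ContinuousAt.mul ?_ ?_) ?_ (Real.rpow_pos_of_pos hnx _).ne'
    · exact (huC' x hx).continuousAt.rpow_const (Or.inl (hup x hx).ne')
    · exact (huC' x hx).continuousAt_gradient.norm.rpow_const (Or.inr (by linarith))
    · exact continuousAt_id.norm.rpow_const (Or.inl hnx.ne')
  have hAc : ∀ x, x ≠ 0 → ContinuousAt (fun x => ‖x‖ ^ θ * u x ^ q) x := fun x hx =>
    (continuousAt_id.norm.rpow_const (Or.inl (norm_pos_iff.2 hx).ne')).mul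
      ((huC' x hx).continuousAt.rpow_const (Or.inl (hup x hx).ne'))
  have hlogc : ContinuousAt (fun y : EuclideanSpace ℝ (Fin N) => Real.log ‖y‖) x₀ :=
    (contDiffAt_log_norm hx₀ (n := 0)).continuousAt
  have hHev : ∀ᶠ x in 𝓝 x₀, ContDiffAt ℝ 2 H (Real.log ‖x‖) :=
    hlogc.eventually (hH.eventually (by simp))
  obtain ⟨r, hr, hball⟩ := Metric.eventually_nhds_iff_ball.1
    (hle.and (hHev.and (isOpen_compl_singleton.mem_nhds hx₀)))
  have hne : ∀ x ∈ Metric.ball x₀ r, x ≠ 0 := fun x hx => (hball x hx).2.2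
  have hQX : ∀ x ∈ Metric.ball x₀ r, HasGradientAt Q (X x) x := fun x hx => by
    have h1 := ((hball x hx).2.1.differentiableAt (by norm_num)).hasDerivAt.comp_hasFDerivAt x
      (hasFDerivAt_log_norm (hne x hx))
    refine hasGradientAt_iff_hasFDerivAt.2 (h1.congr_fderiv ?_)
    ext v
    simp [hX, mul_assoc]
  have hHd : ∀ s, ContDiffAt ℝ 2 H s → ContDiffAt ℝ 1 (deriv H) s := fun s hs => by
    have h := (hs.fderiv_right (m := 1) (by norm_num)).clm_apply
      (contDiffAt_const (c := (1 : ℝ)))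
    exact h
  have hXC : ∀ x ∈ Metric.ball x₀ r, ContDiffAt ℝ 1 X x := fun x hx => by
    have h0 := hne x hx
    have h1 : ContDiffAt ℝ 1 (fun y : EuclideanSpace ℝ (Fin N) => deriv H (Real.log ‖y‖)) x :=
      (hHd _ (hball x hx).2.1).comp x (contDiffAt_log_norm h0)
    exact (h1.mul ((contDiffAt_id.norm_sq ℝ).inv (by simpa using h0))).smul contDiffAt_id
  have key : -divergence X x₀ ≤ g x₀ := by
    refine neg_divergence_le_of_touches_above hr (fun x hx => huC' x (hne x hx))
      (fun x hx => ?_) (fun φ hφC hφc hφs => ?_) hXC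
      (fun x hx => ?_) hQX (fun x hx => (hball x hx).1) heq
    · exact ((continuousAt_const.mul (hDc x (hne x hx))).neg.add
        (continuousAt_const.mul (hGc x (hne x hx)))).sub (hAc x (hne x hx))
    · have hts : ∀ x ∈ tsupport φ, x ≠ 0 := fun x hx => hne x (hφs hx)
      have h := hweak φ ⟨hφC, hφc, fun x hx => ⟨Set.mem_univ _, hts x hx⟩⟩
      have h0 : ∀ x, x ∉ Set.univ \ {(0 : EuclideanSpace ℝ (Fin N))} → x ∉ tsupport φ :=
        fun x hx hx' => hx ⟨Set.mem_univ _, hts x hx'⟩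
      rw [weakE, setIntegral_eq_integral_of_forall_compl_eq_zero fun x hx => by
          simp [gradient_of_notMem_tsupport_s17 (h0 x hx)],
        setIntegral_eq_integral_of_forall_compl_eq_zero fun x hx => by
          simp [image_eq_zero_of_notMem_tsupport (h0 x hx)],
        setIntegral_eq_integral_of_forall_compl_eq_zero fun x hx => by
          simp [image_eq_zero_of_notMem_tsupport (h0 x hx)],
        setIntegral_eq_integral_of_forall_compl_eq_zero fun x hx => by
          simp [image_eq_zero_of_notMem_tsupport (h0 x hx)]] at h
      have i1 := integrable_mul_of_tsupport hφC.continuous hφc fun x hx => hDc x (hts x hx)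
      have i2 := integrable_mul_of_tsupport hφC.continuous hφc fun x hx => hGc x (hts x hx)
      have i3 := integrable_mul_of_tsupport hφC.continuous hφc fun x hx => hAc x (hts x hx)
      have e : (fun x => g x * φ x) = fun x =>
          -(b * (⟪x, gradient u x⟫ / ‖x‖ ^ 2 * φ x)) + lam * (Gt τ x (u x) (gradient u x) * φ x)
            - ‖x‖ ^ θ * u x ^ q * φ x := by
        funext x; simp only [hg]; ring
      have j1 : Integrable fun x => -(b * (⟪x, gradient u x⟫ / ‖x‖ ^ 2 * φ x)) :=
        (i1.const_mul b).neg
      have j2 := i2.const_mul lam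
      have j12 : Integrable fun x => -(b * (⟪x, gradient u x⟫ / ‖x‖ ^ 2 * φ x))
          + lam * (Gt τ x (u x) (gradient u x) * φ x) := j1.add j2
      rw [e, integral_sub j12 i3, integral_add j1 j2, integral_neg,
        integral_const_mul, integral_const_mul]
      linarith
    · exact ((hball x hx).2.1.of_le (by norm_num)).comp x (contDiffAt_log_norm (hne x hx))
  have hgrad : gradient u x₀ = X x₀ := by
    have hmem := Metric.mem_ball_self (x := x₀) hr
    have hmin : IsLocalMin (fun x => Q x - u x) x₀ := by
      filter_upwards [hle] with x hx
      simp only [hQ, heq, sub_self]; exact sub_nonneg.2 hx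
    have h1 := (hQX x₀ hmem).hasFDerivAt.sub
      ((huC' x₀ hx₀).differentiableAt (by norm_num)).hasGradientAt.hasFDerivAt
    have h2 := hmin.hasFDerivAt_eq_zero h1
    rw [← map_sub, LinearIsometryEquiv.map_eq_zero_iff, sub_eq_zero] at h2
    exact h2.symm
  have hn : 0 < ‖x₀‖ := norm_pos_iff.2 hx₀
  have hdiv : divergence X x₀ = _ := divergence_radial hx₀
    ((hHd _ hH).differentiableAt (by norm_num)).hasDerivAt
  have hinner : ⟪x₀, X x₀⟫ = deriv H (Real.log ‖x₀‖) := by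
    simp only [hX, inner_smul_right, real_inner_self_eq_norm_sq]
    field_simp
  have hnormX : ‖X x₀‖ = |deriv H (Real.log ‖x₀‖)| * ‖x₀‖⁻¹ := by
    simp only [hX, norm_smul, Real.norm_eq_abs, abs_mul, abs_inv, abs_pow, abs_norm]
    field_simp
  have hG : Gt τ x₀ (u x₀) (X x₀) = u x₀ ^ τ * |deriv H (Real.log ‖x₀‖)| ^ (1 - τ) * (‖x₀‖ ^ 2)⁻¹ := by
    rw [Gt, hnormX, Real.mul_rpow (abs_nonneg _) (by positivity), Real.inv_rpow hn.le,
      ← mul_assoc, mul_div_assoc, ← one_div, div_div, ← Real.rpow_add hn,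
      show (1 - τ) + (τ + 1) = (2 : ℕ) by push_cast; ring, Real.rpow_natCast, one_div]
  rw [hdiv] at key
  simp only [hg, hgrad] at key
  rw [hinner, hG] at key
  have hpow : ‖x₀‖ ^ (θ + 2) = ‖x₀‖ ^ 2 * ‖x₀‖ ^ θ := by
    rw [Real.rpow_add hn, mul_comm]; norm_cast
  have e1 : ‖x₀‖ ^ 2 * (‖x₀‖ ^ 2)⁻¹ = 1 := mul_inv_cancel₀ (by positivity)
  have hk := mul_le_mul_of_nonneg_left key (sq_nonneg ‖x₀‖)
  rw [hpow]
  rw [div_eq_mul_inv] at hk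
  generalize (‖x₀‖ ^ 2)⁻¹ = i2 at e1 hk
  generalize ‖x₀‖ ^ 2 = n2 at e1 hk ⊢
  generalize deriv (deriv H) (Real.log ‖x₀‖) = D2 at hk ⊢
  generalize deriv H (Real.log ‖x₀‖) = D at hk ⊢
  generalize u x₀ ^ τ * |D| ^ (1 - τ) = V at hk ⊢
  rw [hb] at hk
  linear_combination hk + (D2 - 2 * ρ * D + lam * V) * e1

lemma IsSolutionE.log_radial_touches_above {N : ℕ} {ρ lam τ θ q : ℝ}
    {u : EuclideanSpace ℝ (Fin N) → ℝ} (hτ1 : τ < 1)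
    (hu : IsSolutionE N ρ lam τ θ q Set.univ u) {x₀ : EuclideanSpace ℝ (Fin N)} (hx₀ : x₀ ≠ 0)
    {G y : ℝ → ℝ} {y' : ℝ} (hG : ContDiffAt ℝ 2 G (Real.log ‖x₀‖))
    (hGy : ∀ᶠ s in 𝓝 (Real.log ‖x₀‖), HasDerivAt G (y s) s)
    (hy : HasDerivAt y y' (Real.log ‖x₀‖))
    (hle : ∀ᶠ x in 𝓝 x₀, u x ≤ Real.exp (G (Real.log ‖x‖)))
    (heq : u x₀ = Real.exp (G (Real.log ‖x₀‖))) :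
    ‖x₀‖ ^ (θ + 2) * u x₀ ^ (q - 1) ≤ y' + y (Real.log ‖x₀‖) ^ 2 - 2 * ρ * y (Real.log ‖x₀‖)
      + lam * |y (Real.log ‖x₀‖)| ^ (1 - τ) := by
  have key := hu.radial_touches_above hτ1 hx₀ (H := fun s => Real.exp (G s)) hG.exp hle heq
  have hupos : 0 < u x₀ := heq ▸ Real.exp_pos _
  generalize Real.log ‖x₀‖ = s at *
  have h1 : deriv (fun s => Real.exp (G s)) =ᶠ[𝓝 s] fun s => Real.exp (G s) * y s := by
    filter_upwards [hGy] with t ht using ht.exp.deriv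
  have h2 : deriv (deriv fun s => Real.exp (G s)) s = u x₀ * (y' + y s ^ 2) := by
    have h : HasDerivAt (fun s => Real.exp (G s) * y s) _ s := hGy.self_of_nhds.exp.mul hy
    rw [h1.deriv_eq, h.deriv, heq]
    ring
  have h1' : deriv (fun s => Real.exp (G s)) s = u x₀ * y s := by rw [heq]; exact h1.self_of_nhds
  rw [h2, h1', abs_mul, abs_of_pos hupos,
    Real.mul_rpow hupos.le (abs_nonneg _), ← mul_assoc (u x₀ ^ τ), ← Real.rpow_add hupos,
    add_sub_cancel, Real.rpow_one] at key
  have h3 : u x₀ ^ q = u x₀ * u x₀ ^ (q - 1) := by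
    rw [Real.rpow_sub_one hupos.ne']; field_simp
  rw [h3] at key
  refine le_of_mul_le_mul_left ?_ hupos
  linarith

/-- The logarithm of the barrier `e^{mt} (1 - e^{γt})^{-α} (b - t)^a`, which blows up at `t = 0`. -/
def barrierLog (m γ α a b t : ℝ) : ℝ :=
  m * t - α * Real.log (1 - Real.exp (γ * t)) + a * Real.log (b - t)

/-- The derivative of `barrierLog`. -/
def barrierSlope (m γ α a b t : ℝ) : ℝ :=
  m - a / (b - t) + α * γ * (Real.exp (γ * t) / (1 - Real.exp (γ * t)))

section Barrier

variable {m γ α a b t : ℝ}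

lemma one_sub_exp_mul_pos (hγ : 0 < γ) (ht : t < 0) : 0 < 1 - Real.exp (γ * t) :=
  sub_pos.2 (Real.exp_lt_one_iff.2 (mul_neg_of_pos_of_neg hγ ht))

lemma hasDerivAt_barrierLog (hγ : 0 < γ) (hb : 1 ≤ b) (ht : t < 0) :
    HasDerivAt (barrierLog m γ α a b) (barrierSlope m γ α a b t) t := by
  have h0 := one_sub_exp_mul_pos hγ ht
  have hbt : 0 < b - t := by linarith
  have he : HasDerivAt (fun t => 1 - Real.exp (γ * t)) (-(Real.exp (γ * t) * (γ * 1))) t :=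
    (((hasDerivAt_id t).const_mul γ).exp).const_sub 1
  have h1 := (((hasDerivAt_id t).const_mul m).sub ((he.log h0.ne').const_mul α)).add
    ((((hasDerivAt_id t).const_sub b).log hbt.ne').const_mul a)
  refine h1.congr_deriv ?_
  simp only [barrierSlope, id]
  field_simp
  ring

lemma hasDerivAt_barrierSlope (hγ : 0 < γ) (hb : 1 ≤ b) (ht : t < 0) :
    HasDerivAt (barrierSlope m γ α a b) (-(a / (b - t) ^ 2)
      + α * γ ^ 2 * (Real.exp (γ * t) / (1 - Real.exp (γ * t)) ^ 2)) t := by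
  have h0 := one_sub_exp_mul_pos hγ ht
  have hbt : 0 < b - t := by linarith
  have he : HasDerivAt (fun t => Real.exp (γ * t)) (Real.exp (γ * t) * (γ * 1)) t :=
    ((hasDerivAt_id t).const_mul γ).exp
  have h1 := (((hasDerivAt_const t a).div ((hasDerivAt_id t).const_sub b) hbt.ne').const_sub m).add
    ((he.div (he.const_sub 1) h0.ne').const_mul (α * γ))
  refine h1.congr_deriv ?_
  simp only [id]
  field_simp
  ring

lemma contDiffAt_barrierLog (hγ : 0 < γ) (hb : 1 ≤ b) (ht : t < 0) :
    ContDiffAt ℝ 2 (barrierLog m γ α a b) t := by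
  have h0 := one_sub_exp_mul_pos hγ ht
  have hbt : 0 < b - t := by linarith
  have hA : ContDiffAt ℝ 2 (fun t => 1 - Real.exp (γ * t)) t :=
    contDiffAt_const.sub (contDiffAt_const.mul contDiffAt_id).exp
  have hB : ContDiffAt ℝ 2 (fun t => b - t) t := contDiffAt_const.sub contDiffAt_id
  exact ((contDiffAt_const.mul contDiffAt_id).sub (contDiffAt_const.mul (hA.log h0.ne'))).add
    (contDiffAt_const.mul (hB.log hbt.ne'))

/-- The barrier is a super-solution up to a multiple of its own blow-up rate. -/
lemma barrier_inequality {ρ lam τ : ℝ} (hm : 0 < m) (hγ : 0 < γ) (hα : 0 < α) (hρ : 0 ≤ ρ)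
    (hlam : 0 < lam) (hτ0 : 0 ≤ τ) (ha : 0 ≤ a) (hb : 1 ≤ b) (ht : t < 0)
    (hlow : m / 2 ≤ m - a / (b - t))
    (hF : -(a / (b - t) ^ 2) + (m - a / (b - t)) ^ 2 - 2 * ρ * (m - a / (b - t))
      + lam * (m - a / (b - t)) ^ (1 - τ) ≤ 0) :
    (-(a / (b - t) ^ 2) + α * γ ^ 2 * (Real.exp (γ * t) / (1 - Real.exp (γ * t)) ^ 2))
      + barrierSlope m γ α a b t ^ 2 - 2 * ρ * barrierSlope m γ α a b t
      + lam * |barrierSlope m γ α a b t| ^ (1 - τ)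
    ≤ (α * γ ^ 2 + α * γ * (2 * m + lam * (m / 2) ^ (-τ)) + (α * γ) ^ 2)
      * (Real.exp (γ * t) / (1 - Real.exp (γ * t)) ^ 2) := by
  have h0 := one_sub_exp_mul_pos hγ ht
  have hbt : 0 < b - t := by linarith
  have hy2m : m - a / (b - t) ≤ m := by have := div_nonneg ha hbt.le; linarith
  unfold barrierSlope
  set e := Real.exp (γ * t) with he
  have he0 : 0 < e := Real.exp_pos _
  set y := m - a / (b - t) with hy
  set k2 := -(a / (b - t) ^ 2)
  set w := e / (1 - e) ^ 2 with hw
  set k := α * γ * (e / (1 - e)) with hk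
  have hy0 : 0 < y := by linarith
  have hk0 : 0 ≤ k := by positivity
  have hw0 : 0 < w := by positivity
  have hαγ : 0 < α * γ := by positivity
  have hkw : k ≤ α * γ * w := by
    refine mul_le_mul_of_nonneg_left ?_ hαγ.le
    rw [hw, div_le_div_iff₀ h0 (by positivity)]
    nlinarith [mul_pos he0 h0, mul_pos (mul_pos he0 h0) he0]
  have hk2w : k ^ 2 ≤ (α * γ) ^ 2 * w := by
    rw [hk, mul_pow]
    refine mul_le_mul_of_nonneg_left ?_ (sq_nonneg _)
    rw [div_pow]
    refine div_le_div_of_nonneg_right ?_ (by positivity)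
    nlinarith
  have hpow : (y + k) ^ (1 - τ) ≤ y ^ (1 - τ) + k * (m / 2) ^ (-τ) := by
    have e1 : (y + k) ^ (1 - τ) = (y + k) * (y + k) ^ (-τ) := by
      rw [sub_eq_add_neg, Real.rpow_add (by linarith), Real.rpow_one]
    have e2 : y ^ (1 - τ) = y * y ^ (-τ) := by
      rw [sub_eq_add_neg, Real.rpow_add hy0, Real.rpow_one]
    have l1 : (y + k) ^ (-τ) ≤ y ^ (-τ) :=
      Real.rpow_le_rpow_of_nonpos hy0 (by linarith) (by linarith)
    have l2 : y ^ (-τ) ≤ (m / 2) ^ (-τ) :=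
      Real.rpow_le_rpow_of_nonpos (by linarith) hlow (by linarith)
    rw [e1, e2]
    nlinarith [mul_le_mul_of_nonneg_left l1 (by linarith : 0 ≤ y + k),
      mul_le_mul_of_nonneg_left l2 hk0]
  rw [abs_of_pos (by linarith)]
  have hD : 0 < (m / 2) ^ (-τ) := Real.rpow_pos_of_pos (by linarith) _
  set D := (m / 2) ^ (-τ)
  have hlp := mul_le_mul_of_nonneg_left hpow hlam.le
  have h1 : 2 * y * k ≤ 2 * m * (α * γ * w) := by nlinarith
  have h2 : lam * (k * D) ≤ lam * (α * γ * w * D) := by gcongr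
  have h3 : 0 ≤ 2 * ρ * k := by positivity
  nlinarith

lemma tendsto_exp_mul_barrierLog_atBot {c K : ℝ} (hγ : 0 < γ) (hcm : 0 < c + m) :
    Tendsto (fun t => Real.exp (K + c * t + barrierLog m γ α a b t)) atBot (𝓝 0) := by
  refine Real.tendsto_exp_atBot.comp ?_
  have h1 : Tendsto (fun t => Real.log (1 - Real.exp (γ * t))) atBot (𝓝 0) := by
    have h : Tendsto (fun t => 1 - Real.exp (γ * t)) atBot (𝓝 1) := by
      simpa using (Real.tendsto_exp_atBot.comp (tendsto_id.const_mul_atBot hγ)).const_sub 1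
    simpa [Function.comp_def] using (Real.continuousAt_log one_ne_zero).tendsto.comp h
  have h2 : Tendsto (fun t => b - t) atBot atTop :=
    tendsto_atTop_add_const_left _ b tendsto_neg_atBot_atTop
  have h3 : Tendsto (fun r : ℝ => (K - (c + m) * r) + ((c + m) * b + a * Real.log r))
      atTop atBot := by
    have h4 : (fun r : ℝ => (K + (c + m) * b) + a * Real.log r) =o[atTop] fun r : ℝ => r :=
      (Asymptotics.isLittleO_const_id_atTop _).add
        (Real.isLittleO_log_id_atTop.const_mul_left a)
    have h5 := h4.bound (half_pos hcm)
    refine tendsto_atBot_mono' _ (f₁ := fun r : ℝ => -((c + m) / 2 * r)) ?_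
      (tendsto_neg_atTop_atBot.comp (tendsto_id.const_mul_atTop (half_pos hcm)))
    filter_upwards [h5, eventually_ge_atTop 0] with r hr hr0
    have := (le_abs_self _).trans hr
    rw [Real.norm_eq_abs, abs_of_nonneg hr0] at this
    linarith
  have h6 := (h3.comp h2).atBot_add (h1.const_mul (-α))
  refine h6.congr fun t => ?_
  simp only [Function.comp, barrierLog]
  ring

end Barrier

lemma one_sub_mul_sub_one_lt_rpow_neg {τ x : ℝ} (hτ : 0 < τ) (hx : 0 < x) (hx1 : x ≠ 1) :
    1 - τ * (x - 1) < x ^ (-τ) := by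
  have h1 := Real.log_lt_sub_one_of_pos hx hx1
  have h2 := Real.add_one_le_exp (Real.log x * -τ)
  rw [← Real.rpow_def_of_pos hx] at h2
  nlinarith

lemma one_add_mul_le_one_sub_rpow_neg {τ d : ℝ} (hτ : 0 ≤ τ) (hd : d < 1) :
    1 + τ * d ≤ (1 - d) ^ (-τ) := by
  have h1 := Real.log_le_sub_one_of_pos (sub_pos.2 hd)
  have h2 := Real.add_one_le_exp (Real.log (1 - d) * -τ)
  rw [← Real.rpow_def_of_pos (sub_pos.2 hd)] at h2
  nlinarith

/-- Second-order Taylor upper bound for the concave power `(1 - d)^(1 - τ)`. -/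
lemma one_sub_rpow_le {τ d : ℝ} (hτ0 : 0 ≤ τ) (hτ1 : τ ≤ 1) (hd0 : 0 ≤ d) (hd1 : d < 1) :
    (1 - d) ^ (1 - τ) ≤ 1 - (1 - τ) * d - τ * (1 - τ) / 2 * d ^ 2 := by
  let g : ℝ → ℝ := fun d => 1 - (1 - τ) * d - τ * (1 - τ) / 2 * d ^ 2 - (1 - d) ^ (1 - τ)
  have hg : ∀ x < 1, HasDerivAt g ((1 - τ) * ((1 - x) ^ (-τ) - (1 + τ * x))) x := by
    intro x hx
    have h1 : HasDerivAt (fun d : ℝ => (1 - d) ^ (1 - τ)) _ x :=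
      ((hasDerivAt_id x).const_sub 1).rpow_const (Or.inl (sub_pos.2 hx).ne')
    have h2 := ((((hasDerivAt_id x).const_mul (1 - τ)).const_sub 1).sub
      (((hasDerivAt_id x).pow 2).const_mul (τ * (1 - τ) / 2))).sub h1
    refine h2.congr_deriv ?_
    simp only [id]
    rw [show 1 - τ - 1 = -τ by ring]
    ring
  have hmono : MonotoneOn g (Set.Ico 0 1) := by
    refine monotoneOn_of_deriv_nonneg (convex_Ico 0 1)
      (fun x hx => (hg x hx.2).continuousAt.continuousWithinAt) ?_ ?_
    · intro x hx
      rw [interior_Ico] at hx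
      exact (hg x hx.2).differentiableAt.differentiableWithinAt
    · intro x hx
      rw [interior_Ico] at hx
      rw [(hg x hx.2).deriv]
      exact mul_nonneg (by linarith)
        (sub_nonneg.2 (one_add_mul_le_one_sub_rpow_neg hτ0 hx.2))
  have h := hmono (Set.left_mem_Ico.2 one_pos) ⟨hd0, hd1⟩ hd0
  simp only [g, sub_zero, Real.one_rpow] at h
  linarith

/-- In the critical case `ρ = Υ` the root is the double root `(λτ)^(1/(τ+1))`. -/
lemma two_mul_Upsilon_mul_eq {lam τ m : ℝ} (hlam : 0 < lam) (hτ0 : 0 < τ) (hm : 0 < m)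
    (hF : m ^ 2 - 2 * Upsilon lam τ * m + lam * m ^ (1 - τ) = 0) :
    2 * Upsilon lam τ * τ = (1 + τ) * m := by
  have hlt : 0 < lam * τ := by positivity
  set m₀ := (lam * τ) ^ (1 / (τ + 1)) with hm₀
  have hm₀pos : 0 < m₀ := Real.rpow_pos_of_pos hlt _
  have hpow : m₀ ^ (τ + 1) = lam * τ := by
    rw [hm₀, ← Real.rpow_mul hlt.le, one_div_mul_cancel (by positivity), Real.rpow_one]
  have hU : 2 * Upsilon lam τ * τ = (1 + τ) * m₀ := by
    unfold Upsilon; rw [← hm₀]; field_simp; ring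
  suffices m = m₀ by rw [hU, this]
  by_contra hne
  have hx : 0 < m / m₀ := by positivity
  have h1 := one_sub_mul_sub_one_lt_rpow_neg hτ0 hx (fun h => hne ((div_eq_one_iff_eq hm₀pos.ne').1 h))
  have h2 : (m / m₀) ^ (-τ) * (m * m₀) = lam * τ * m ^ (1 - τ) := by
    rw [← hpow, Real.div_rpow hm.le hm₀pos.le, Real.rpow_add hm₀pos, Real.rpow_one,
      sub_eq_add_neg 1 τ, Real.rpow_add hm, Real.rpow_one, Real.rpow_neg hm₀pos.le]
    have := (Real.rpow_pos_of_pos hm₀pos τ).ne'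
    field_simp
  have h3 := mul_lt_mul_of_pos_right h1 (mul_pos hm hm₀pos)
  rw [h2] at h3
  have h4 : (1 - τ * (m / m₀ - 1)) * (m * m₀) = (1 + τ) * m₀ * m - τ * m ^ 2 := by
    field_simp; ring
  rw [h4, ← hU] at h3
  nlinarith

lemma le_sq_of_eq_Upsilon {lam τ m y : ℝ} (hlam : 0 < lam) (hτ0 : 0 < τ) (hτ1 : τ < 1)
    (hm : 0 < m) (hF : m ^ 2 - 2 * Upsilon lam τ * m + lam * m ^ (1 - τ) = 0)
    (hy : 0 < y) (hym : y ≤ m) :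
    y ^ 2 - 2 * Upsilon lam τ * y + lam * y ^ (1 - τ) ≤ (1 + τ) / 2 * (m - y) ^ 2 := by
  have hU := two_mul_Upsilon_mul_eq hlam hτ0 hm hF
  set U := Upsilon lam τ
  obtain ⟨d, rfl⟩ : ∃ d, y = m * (1 - d) := ⟨1 - y / m, by field_simp; ring⟩
  have hd1 : 0 < 1 - d := pos_of_mul_pos_right hy hm.le
  have hd0 : 0 ≤ d := by nlinarith
  have h1 := one_sub_rpow_le hτ0.le hτ1.le hd0 (by linarith)
  rw [Real.mul_rpow hm.le hd1.le]
  have h2 : lam * m ^ (1 - τ) * τ = m ^ 2 := by linear_combination τ * hF + m * hU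
  have h3 := mul_le_mul_of_nonneg_left h1 (sq_nonneg m)
  refine le_of_mul_le_mul_right ?_ hτ0
  have h4 : ((m * (1 - d)) ^ 2 - 2 * U * (m * (1 - d))
      + lam * (m ^ (1 - τ) * (1 - d) ^ (1 - τ))) * τ
      = m ^ 2 * (1 - d) ^ 2 * τ - (1 + τ) * m ^ 2 * (1 - d) + m ^ 2 * (1 - d) ^ (1 - τ) := by
    linear_combination (-(m * (1 - d))) * hU + (1 - d) ^ (1 - τ) * h2
  rw [h4]
  nlinarith

/-- In Case [N₂], `Φ_{ϖ₂}(r) = r^(-ϖ₂) |log r|^a` where `a` is such that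
`e^{-ϖ₂ t} (b - t)^a` is a super-solution of the linear part of the equation in `t = log r`. -/
lemma exists_barrier_exponents {ρ lam τ w : ℝ} (hcase : CaseN2 ρ lam τ)
    (hw : w < 0) (hroot : fRho ρ lam τ w = 0) :
    ∃ a b : ℝ, 0 ≤ a ∧ 1 ≤ b ∧ (∀ r, Phi2 ρ lam τ w r = r ^ (-w) * |Real.log r| ^ a) ∧
      ∀ t < 0, -w / 2 ≤ -w - a / (b - t) ∧
        -(a / (b - t) ^ 2) + (-w - a / (b - t)) ^ 2 - 2 * ρ * (-w - a / (b - t))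
          + lam * (-w - a / (b - t)) ^ (1 - τ) ≤ 0 := by
  obtain ⟨hlam, hτ0, hτ1, -⟩ := hcase
  obtain ⟨m, rfl⟩ : ∃ m, w = -m := ⟨-w, by ring⟩
  have hm : 0 < m := by linarith
  have hF : m ^ 2 - 2 * ρ * m + lam * m ^ (1 - τ) = 0 := by
    unfold fRho at hroot
    rw [abs_neg, abs_of_pos hm] at hroot
    linarith
  simp only [neg_neg]
  by_cases hρ : ρ = Upsilon lam τ
  · have ha : 0 < 2 / (1 + τ) := by positivity
    refine ⟨2 / (1 + τ), max 1 (2 * (2 / (1 + τ)) / m), ha.le, le_max_left _ _,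
      fun r => by simp [Phi2, hρ], fun t ht => ?_⟩
    set b := max 1 (2 * (2 / (1 + τ)) / m)
    have hb1 : 1 ≤ b := le_max_left _ _
    have hbm : 2 * (2 / (1 + τ)) ≤ b * m := (div_le_iff₀ hm).1 (le_max_right _ _)
    have hbt : 0 < b - t := by linarith
    have hlow : 2 / (1 + τ) / (b - t) ≤ m / 2 := by
      rw [div_le_iff₀ hbt]
      nlinarith
    refine ⟨by linarith, ?_⟩
    have hpos : 0 < 2 / (1 + τ) / (b - t) := by positivity
    subst hρ
    have h := le_sq_of_eq_Upsilon hlam hτ0 hτ1 hm hF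
      (y := m - 2 / (1 + τ) / (b - t)) (by linarith) (by linarith)
    have h2 : (1 + τ) / 2 * (m - (m - 2 / (1 + τ) / (b - t))) ^ 2
        = 2 / (1 + τ) / (b - t) ^ 2 := by
      field_simp
      ring
    linarith
  · exact ⟨0, 1, le_rfl, le_rfl, fun r => by simp [Phi2, hρ], fun t ht => ⟨by simp; linarith,
      by simpa using hF.le⟩⟩

lemma Upsilon_pos {lam τ : ℝ} (hlam : 0 < lam) (hτ : 0 < τ) : 0 < Upsilon lam τ := by
  unfold Upsilon
  positivity

lemma eventually_lt_exp_barrierLog {N : ℕ} {u : EuclideanSpace ℝ (Fin N) → ℝ}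
    {m γ α a b S : ℝ} (K : ℝ) (hγ : 0 < γ) (hα : 0 ≤ α) (ha : 0 ≤ a) (hb : 1 ≤ b) (hS : 0 ≤ S)
    (hsmall : Tendsto (fun x : EuclideanSpace ℝ (Fin N) =>
      u x / (‖x‖ ^ m * |Real.log ‖x‖| ^ a)) (𝓝[≠] 0) (𝓝 0)) :
    ∀ᶠ x in 𝓝[≠] (0 : EuclideanSpace ℝ (Fin N)),
      u x < Real.exp (K + barrierLog m γ α a b (Real.log ‖x‖ - S)) := by
  filter_upwards [hsmall.eventually_lt_const (Real.exp_pos (K - m * S)), self_mem_nhdsWithin,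
    nhdsWithin_le_nhds (Metric.ball_mem_nhds (0 : EuclideanSpace ℝ (Fin N)) one_pos)]
    with x hx hx0 hx1
  have hn : 0 < ‖x‖ := norm_pos_iff.2 hx0
  have hs : Real.log ‖x‖ < 0 := Real.log_neg hn (by simpa using hx1)
  rw [Real.rpow_def_of_pos hn, Real.rpow_def_of_pos (abs_pos.2 hs.ne), abs_of_neg hs,
    ← Real.exp_add, div_lt_iff₀ (Real.exp_pos _), ← Real.exp_add] at hx
  refine hx.trans_le (Real.exp_le_exp.2 ?_)
  have h0 := one_sub_exp_mul_pos hγ (show Real.log ‖x‖ - S < 0 by linarith)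
  have h1 := Real.log_nonpos h0.le (by linarith [Real.exp_pos (γ * (Real.log ‖x‖ - S))])
  have h2 : Real.log (-Real.log ‖x‖) ≤ Real.log (b - (Real.log ‖x‖ - S)) :=
    Real.log_le_log (by linarith) (by linarith)
  unfold barrierLog
  nlinarith [mul_le_mul_of_nonneg_left h2 ha, mul_nonneg hα (neg_nonneg.2 h1)]

section Comparison

variable {N : ℕ} {ρ lam τ θ q : ℝ} {u : EuclideanSpace ℝ (Fin N) → ℝ} {m γ α a b S K : ℝ}

/-- A multiple `e^L > 1` of the barrier cannot touch a solution from above. -/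
lemma IsSolutionE.not_touches_barrier (hu : IsSolutionE N ρ lam τ θ q Set.univ u)
    (hτ0 : 0 ≤ τ) (hτ1 : τ < 1) (hq : 1 < q) (hlam : 0 < lam) (hρ : 0 ≤ ρ) (hm : 0 < m)
    (hγ : 0 < γ) (ha : 0 ≤ a) (hb : 1 ≤ b) (hγm : θ + 2 + (q - 1) * m = γ)
    (hα : (q - 1) * α = 2)
    (hbar : ∀ t < 0, m / 2 ≤ m - a / (b - t) ∧
      -(a / (b - t) ^ 2) + (m - a / (b - t)) ^ 2 - 2 * ρ * (m - a / (b - t))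
        + lam * (m - a / (b - t)) ^ (1 - τ) ≤ 0)
    (hK : α * γ ^ 2 + α * γ * (2 * m + lam * (m / 2) ^ (-τ)) + (α * γ) ^ 2
      = Real.exp ((q - 1) * K + (θ + 2) * S))
    {x₀ : EuclideanSpace ℝ (Fin N)} (hx₀ : x₀ ≠ 0) (hlog : Real.log ‖x₀‖ < S)
    {L : ℝ} (hL : 0 < L)
    (heq : u x₀ = Real.exp (L + K + barrierLog m γ α a b (Real.log ‖x₀‖ - S))) :
    ¬ ∀ᶠ x in 𝓝 x₀, u x ≤ Real.exp (L + K + barrierLog m γ α a b (Real.log ‖x‖ - S)) := by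
  intro hle
  have hαpos : 0 < α := by
    by_contra h
    nlinarith
  have ht : Real.log ‖x₀‖ - S < 0 := by linarith
  have key := hu.log_radial_touches_above hτ1 hx₀
    (G := fun s => L + K + barrierLog m γ α a b (s - S))
    (y := fun s => barrierSlope m γ α a b (s - S))
    (contDiffAt_const.add ((contDiffAt_barrierLog hγ hb ht).comp (Real.log ‖x₀‖)
      (contDiffAt_id.sub contDiffAt_const)))
    (by
      filter_upwards [Iio_mem_nhds hlog] with s hs
      exact ((hasDerivAt_barrierLog hγ hb (sub_neg.2 hs)).comp_sub_const s S).const_add (L + K))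
    ((hasDerivAt_barrierSlope hγ hb ht).comp_sub_const (Real.log ‖x₀‖) S) hle heq
  have hineq := barrier_inequality hm hγ hαpos hρ hlam hτ0 ha hb ht (hbar _ ht).1 (hbar _ ht).2
  have hlt := key.trans hineq
  have h0 := one_sub_exp_mul_pos hγ ht
  have hsq : (1 - Real.exp (γ * (Real.log ‖x₀‖ - S))) ^ 2
      = Real.exp (2 * Real.log (1 - Real.exp (γ * (Real.log ‖x₀‖ - S)))) := by
    rw [two_mul, Real.exp_add, Real.exp_log h0, sq]
  rw [hK, hsq, ← Real.exp_sub, ← Real.exp_add, heq, ← Real.exp_mul,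
    Real.rpow_def_of_pos (norm_pos_iff.2 hx₀), ← Real.exp_add, Real.exp_le_exp] at hlt
  have hlb : 0 ≤ Real.log (b - (Real.log ‖x₀‖ - S)) := Real.log_nonneg (by linarith)
  have h1 : 0 ≤ (q - 1) * (a * Real.log (b - (Real.log ‖x₀‖ - S))) :=
    mul_nonneg (by linarith) (mul_nonneg ha hlb)
  have h2 : 0 < (q - 1) * L := mul_pos (by linarith) hL
  unfold barrierLog at hlt
  set l := Real.log (1 - Real.exp (γ * (Real.log ‖x₀‖ - S)))
  have h3 : (q - 1) * α * l = 2 * l := by rw [hα]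
  have h4 : (θ + 2 + (q - 1) * m) * (Real.log ‖x₀‖ - S) = γ * (Real.log ‖x₀‖ - S) := by rw [hγm]
  linarith

lemma exp_neg_barrierLog (hγ : 0 < γ) (hb : 1 ≤ b) {t : ℝ} (ht : t < 0) :
    Real.exp (-K - m * t) * (1 - Real.exp (γ * t)) ^ α * (b - t) ^ (-a)
      = Real.exp (-(K + barrierLog m γ α a b t)) := by
  rw [Real.rpow_def_of_pos (one_sub_exp_mul_pos hγ ht),
    Real.rpow_def_of_pos (show 0 < b - t by linarith), ← Real.exp_add, ← Real.exp_add]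
  unfold barrierLog
  congr 1
  ring

/-- Solutions that are small at the origin lie below the barrier. -/
lemma IsSolutionE.le_exp_barrierLog (hu : IsSolutionE N ρ lam τ θ q Set.univ u)
    (hτ0 : 0 ≤ τ) (hτ1 : τ < 1) (hq : 1 < q) (hlam : 0 < lam) (hρ : 0 ≤ ρ) (hm : 0 < m)
    (hγ : 0 < γ) (ha : 0 ≤ a) (hb : 1 ≤ b) (hS : 0 ≤ S) (hγm : θ + 2 + (q - 1) * m = γ)
    (hα : (q - 1) * α = 2)
    (hbar : ∀ t < 0, m / 2 ≤ m - a / (b - t) ∧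
      -(a / (b - t) ^ 2) + (m - a / (b - t)) ^ 2 - 2 * ρ * (m - a / (b - t))
        + lam * (m - a / (b - t)) ^ (1 - τ) ≤ 0)
    (hK : α * γ ^ 2 + α * γ * (2 * m + lam * (m / 2) ^ (-τ)) + (α * γ) ^ 2
      = Real.exp ((q - 1) * K + (θ + 2) * S))
    (hsmall : Tendsto (fun x : EuclideanSpace ℝ (Fin N) =>
      u x / (‖x‖ ^ m * |Real.log ‖x‖| ^ a)) (𝓝[≠] 0) (𝓝 0))
    {x₁ : EuclideanSpace ℝ (Fin N)} (hx₁ : x₁ ≠ 0) (hlog : Real.log ‖x₁‖ < S) :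
    u x₁ ≤ Real.exp (K + barrierLog m γ α a b (Real.log ‖x₁‖ - S)) := by
  by_contra! hgt
  have hαpos : 0 < α := by
    by_contra h
    nlinarith
  have hev := eventually_lt_exp_barrierLog K hγ hαpos.le ha hb hS hsmall
  obtain ⟨δ, hδ, hball⟩ := Metric.mem_nhdsWithin_iff.1 hev
  have hnear : ∀ x, x ≠ 0 → ‖x‖ < δ →
      u x < Real.exp (K + barrierLog m γ α a b (Real.log ‖x‖ - S)) :=
    fun x hx hxδ => hball ⟨by simpa using hxδ, hx⟩
  let A : Set (EuclideanSpace ℝ (Fin N)) :=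
    Metric.closedBall 0 (Real.exp S) \ Metric.ball 0 δ
  have hA : IsCompact A := (isCompact_closedBall _ _).diff Metric.isOpen_ball
  have hmemA : ∀ x, x ∈ A ↔ ‖x‖ ≤ Real.exp S ∧ δ ≤ ‖x‖ := fun x => by simp [A]
  have hA0 : ∀ x ∈ A, x ≠ 0 := fun x hx => norm_pos_iff.1 (hδ.trans_le ((hmemA x).1 hx).2)
  let W : ℝ → ℝ := fun t =>
    Real.exp (-K - m * t) * (1 - Real.exp (γ * t)) ^ α * (b - t) ^ (-a)
  let v : EuclideanSpace ℝ (Fin N) → ℝ := fun x => u x * W (Real.log ‖x‖ - S)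
  have hlogle : ∀ x ∈ A, Real.log ‖x‖ ≤ S := fun x hx =>
    (Real.log_le_iff_le_exp (norm_pos_iff.2 (hA0 x hx))).2 ((hmemA x).1 hx).1
  have hvcont : ContinuousOn v A := by
    intro x hx
    have hx0 := hA0 x hx
    have hux : ContinuousAt u x := hu.1.1.continuousOn.continuousAt
      ((isOpen_univ.sdiff isClosed_singleton).mem_nhds ⟨Set.mem_univ _, hx0⟩)
    have hlx : ContinuousAt (fun x : EuclideanSpace ℝ (Fin N) => Real.log ‖x‖ - S) x :=
      (contDiffAt_log_norm hx0 (n := 1)).continuousAt.sub continuousAt_const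
    have hW : ContinuousAt W (Real.log ‖x‖ - S) := by
      refine ContinuousAt.mul (ContinuousAt.mul ?_ ?_) ?_
      · fun_prop
      · exact ContinuousAt.rpow_const (by fun_prop) (Or.inr hαpos.le)
      · refine ContinuousAt.rpow_const (by fun_prop) (Or.inl ?_)
        have := hlogle x hx
        exact (show 0 < b - (Real.log ‖x‖ - S) by linarith).ne'
    exact (hux.mul (ContinuousAt.comp (f := fun x : EuclideanSpace ℝ (Fin N) =>
      Real.log ‖x‖ - S) hW hlx)).continuousWithinAt
  have hv : ∀ x, Real.log ‖x‖ < S →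
      v x = u x * Real.exp (-(K + barrierLog m γ α a b (Real.log ‖x‖ - S))) := fun x hx => by
    simp only [v, W]
    rw [exp_neg_barrierLog hγ hb (sub_neg.2 hx)]
  have hx₁A : x₁ ∈ A := by
    refine (hmemA x₁).2 ⟨((Real.log_lt_iff_lt_exp (norm_pos_iff.2 hx₁)).1 hlog).le, ?_⟩
    by_contra! h
    exact lt_asymm hgt (hnear x₁ hx₁ h)
  have hv₁ : 1 < v x₁ := by
    rw [hv x₁ hlog, Real.exp_neg, ← div_eq_mul_inv, one_lt_div (Real.exp_pos _)]
    exact hgt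
  obtain ⟨x₀, hx₀A, hmax⟩ := hA.exists_isMaxOn ⟨x₁, hx₁A⟩ hvcont
  have hx₀ := hA0 x₀ hx₀A
  have hM : 1 < v x₀ := hv₁.trans_le (hmax hx₁A)
  have hlog₀ : Real.log ‖x₀‖ < S := by
    refine lt_of_le_of_ne (hlogle x₀ hx₀A) fun h => ?_
    have : v x₀ = 0 := by simp [v, W, h, Real.zero_rpow hαpos.ne']
    linarith
  have hexp : ∀ x : EuclideanSpace ℝ (Fin N),
      Real.exp (Real.log (v x₀) + K + barrierLog m γ α a b (Real.log ‖x‖ - S))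
      = v x₀ * Real.exp (K + barrierLog m γ α a b (Real.log ‖x‖ - S)) := fun x => by
    rw [add_assoc, Real.exp_add, Real.exp_log (by linarith)]
  refine hu.not_touches_barrier hτ0 hτ1 hq hlam hρ hm hγ ha hb hγm hα hbar hK hx₀ hlog₀
    (Real.log_pos hM) ?_ ?_
  · rw [hexp, hv x₀ hlog₀, mul_assoc, ← Real.exp_add, neg_add_cancel, Real.exp_zero, mul_one]
  · have hcont : ContinuousAt (fun x : EuclideanSpace ℝ (Fin N) => Real.log ‖x‖) x₀ :=
      (contDiffAt_log_norm hx₀ (n := 1)).continuousAt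
    filter_upwards [hcont.eventually_lt_const hlog₀, eventually_ne_nhds hx₀] with x hxS hx0
    rw [hexp]
    have hE := Real.exp_pos (K + barrierLog m γ α a b (Real.log ‖x‖ - S))
    rcases lt_or_ge ‖x‖ δ with hxδ | hxδ
    · exact (hnear x hx0 hxδ).le.trans (le_mul_of_one_le_left hE.le hM.le)
    · have h := hmax ((hmemA x).2
        ⟨((Real.log_lt_iff_lt_exp (norm_pos_iff.2 hx0)).1 hxS).le, hxδ⟩)
      change v x ≤ v x₀ at h
      rwa [hv x hxS, Real.exp_neg, ← div_eq_mul_inv, div_le_iff₀ hE] at h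

end Comparison

/-- If `β ∈ (ϖ₂, 0)` in Case [N₂], then there is no positive solution `u`
of (E) in `ℝ^N \ {0}` with `u(x)/Φ_{ϖ₂}(|x|) → 0` as `|x| → 0`. -/
theorem stmt17_nonexistence_small_solution
    (N : ℕ) (hN : 2 ≤ N) (ρ lam τ θ q : ℝ)
    (hτ0 : 0 ≤ τ) (hτ1 : τ < 1) (hq : 1 < q)
    (hcase : CaseN2 ρ lam τ)
    (w2 : ℝ) (hw2 : IsMaxNegRoot ρ lam τ w2)
    (hβ1 : w2 < (θ + 2) / (q - 1)) (hβ2 : (θ + 2) / (q - 1) < 0) :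
    ¬ ∃ u : EuclideanSpace ℝ (Fin N) → ℝ,
        IsSolutionE N ρ lam τ θ q Set.univ u ∧
        Filter.Tendsto (fun x : EuclideanSpace ℝ (Fin N) => u x / Phi2 ρ lam τ w2 ‖x‖)
          (𝓝[≠] (0 : EuclideanSpace ℝ (Fin N))) (𝓝 0) := by
  rintro ⟨u, hu, hlim⟩
  obtain ⟨hw, hroot, -⟩ := hw2
  obtain ⟨a, b, ha, hb, hPhi, hbar⟩ := exists_barrier_exponents hcase hw hroot
  obtain ⟨hlam, hτ, -, hΥ⟩ := hcase
  have hρ : 0 ≤ ρ := (Upsilon_pos hlam hτ).le.trans hΥ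
  simp only [hPhi] at hlim
  have hq1 : 0 < q - 1 := by linarith
  have hm : 0 < -w2 := by linarith
  set β := (θ + 2) / (q - 1) with hβ
  have hθ : θ + 2 = (q - 1) * β := by rw [hβ]; field_simp
  have hγ : 0 < θ + 2 + (q - 1) * -w2 := by rw [hθ]; nlinarith
  set γ := θ + 2 + (q - 1) * -w2 with hγdef
  set α := 2 / (q - 1) with hα
  have hα0 : 0 < α := by positivity
  have hqα : (q - 1) * α = 2 := by rw [hα]; field_simp
  set B := α * γ ^ 2 + α * γ * (2 * -w2 + lam * (-w2 / 2) ^ (-τ)) + (α * γ) ^ 2 with hB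
  have hBpos : 0 < B := by
    have := Real.rpow_pos_of_pos (half_pos hm) (-τ)
    positivity
  let x₁ : EuclideanSpace ℝ (Fin N) := EuclideanSpace.single ⟨0, by omega⟩ 1
  have hx₁ : ‖x₁‖ = 1 := by simp [x₁]
  have hx₁0 : x₁ ≠ 0 := norm_pos_iff.1 (by rw [hx₁]; exact one_pos)
  have hbound : ∀ᶠ t in atBot, u x₁
      ≤ Real.exp (Real.log B / (q - 1) + β * t + barrierLog (-w2) γ α a b t) := by
    filter_upwards [eventually_lt_atBot 0] with t ht
    have h := hu.le_exp_barrierLog hτ0 hτ1 hq hlam hρ hm hγ ha hb (S := -t)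
      (K := Real.log B / (q - 1) + β * t) (by linarith) rfl hqα hbar
      (by
        rw [← hB, hθ, mul_add, mul_div_cancel₀ _ hq1.ne']
        rw [show Real.log B + (q - 1) * (β * t) + (q - 1) * β * -t = Real.log B by ring,
          Real.exp_log hBpos])
      hlim hx₁0 (by rw [hx₁, Real.log_one]; linarith)
    simpa [hx₁] using h
  have hle := ge_of_tendsto (tendsto_exp_mul_barrierLog_atBot hγ (by linarith)) hbound
  exact absurd (hu.1.2 x₁ ⟨Set.mem_univ _, hx₁0⟩) hle.not_gt

end
end
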